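/- arXiv:0805.0016 — 4 statements merged into one kernel-verified Lean document; each statement's English description precedes it below -/
import Mathlib

section
/- Let n be a positive integer divisible by 3, let Π be a 3-decomposable halfperiod on n elements with wings A, B, C, and let k be an integer with n/3 < k < n/2. Then the number of monochromatic (≤k)-critical transpositions of Π satisfies N^{mono}_{≤k}(Π) ≥ B(k,n) − 3·binom(n/3+1,2) − (k − n/3)·n. -/
/-- A halfperiod on `n` elements: a sequence `pos 0, pos 1, …, pos (C(n,2))` of linear orderings
of `Fin n` (given by the position `pos t x` of element `x` at time `t`), where consecutive
orderings differ by transposing the elements in positions `move t` and `move t + 1`, and the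
final ordering is the reverse of the initial one. Positions are numbered `0, …, n-1`, so the
swap at step `t` is the paper's `(move t + 1)`-transposition. -/
structure Halfperiod (n : ℕ) where
  pos : ℕ → (Fin n ≃ Fin n)
  move : ℕ → ℕ
  move_lt : ∀ t, t < n.choose 2 → move t + 1 < n
  step : ∀ t, t < n.choose 2 → ∀ x : Fin n,
    ((pos (t + 1)) x : ℕ) =
      if ((pos t) x : ℕ) = move t then move t + 1
      else if ((pos t) x : ℕ) = move t + 1 then move t
      else ((pos t) x : ℕ)
  reverse : ∀ x : Fin n, ((pos (n.choose 2)) x : ℕ) = n - 1 - ((pos 0) x : ℕ)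

/-- A halfperiod is 3-decomposable with wings `A`, `B`, `C` if the wings partition the ground set
into three parts of size `n/3`, in the initial ordering all of `A` precedes all of `B`, which
precedes all of `C`, and there are indices `0 < s < t ≤ C(n,2)` such that at time `s+1` the
order of the wings is `B, A, C` and at time `t+1` it is `B, C, A`. -/
def Halfperiod.ThreeDecomp {n : ℕ} (H : Halfperiod n) (A B C : Finset (Fin n)) : Prop :=
  3 * A.card = n ∧ 3 * B.card = n ∧ 3 * C.card = n ∧
  Disjoint A B ∧ Disjoint A C ∧ Disjoint B C ∧ A ∪ B ∪ C = Finset.univ ∧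
  (∀ a ∈ A, ∀ b ∈ B, H.pos 0 a < H.pos 0 b) ∧
  (∀ b ∈ B, ∀ c ∈ C, H.pos 0 b < H.pos 0 c) ∧
  ∃ s t : ℕ, 0 < s ∧ s < t ∧ t ≤ n.choose 2 ∧
    (∀ b ∈ B, ∀ a ∈ A, H.pos (s + 1) b < H.pos (s + 1) a) ∧
    (∀ a ∈ A, ∀ c ∈ C, H.pos (s + 1) a < H.pos (s + 1) c) ∧
    (∀ b ∈ B, ∀ c ∈ C, H.pos (t + 1) b < H.pos (t + 1) c) ∧
    (∀ c ∈ C, ∀ a ∈ A, H.pos (t + 1) c < H.pos (t + 1) a)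

/-- The transposition at step `t` is `(≤ k)`-critical: it is an `i`-transposition or an
`(n-i)`-transposition for some `i ≤ k` (in the paper's 1-based indexing `i = move t + 1`). -/
def Halfperiod.CritAt {n : ℕ} (H : Halfperiod n) (k t : ℕ) : Prop :=
  H.move t + 1 ≤ k ∨ n - k ≤ H.move t + 1

/-- `NcritLe n k H` is the number of `(≤ k)`-critical transpositions of the halfperiod `H`. -/
noncomputable def NcritLe (n k : ℕ) (H : Halfperiod n) : ℕ :=
  Set.ncard {t : ℕ | t < n.choose 2 ∧ H.CritAt k t}

/-- The transposition at step `t` is monochromatic with respect to the wings `A`, `B`, `C`: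
the two exchanged elements (those in positions `move t` and `move t + 1` at time `t`)
belong to the same wing. -/
def Halfperiod.MonoAt {n : ℕ} (H : Halfperiod n) (A B C : Finset (Fin n)) (t : ℕ) : Prop :=
  ∀ x y : Fin n, (H.pos t x : ℕ) = H.move t → (H.pos t y : ℕ) = H.move t + 1 →
    ((x ∈ A ∧ y ∈ A) ∨ (x ∈ B ∧ y ∈ B) ∨ (x ∈ C ∧ y ∈ C))

/-- The number of monochromatic `(≤ k)`-critical transpositions. -/
noncomputable def NcritMono (n k : ℕ) (H : Halfperiod n) (A B C : Finset (Fin n)) : ℕ :=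
  Set.ncard {t : ℕ | t < n.choose 2 ∧ H.CritAt k t ∧ H.MonoAt A B C t}

/-- The formal binomial coefficient `binom(r,2)` of a real number: `r(r-1)/2` if `r ≥ 2`,
and `0` otherwise. -/
noncomputable def rbinom2 (r : ℝ) : ℝ := if 2 ≤ r then r * (r - 1) / 2 else 0

/-- `cseq j = 1/2 − 1/(3j(j+1))`. -/
noncomputable def cseq (j : ℕ) : ℝ := 1 / 2 - 1 / (3 * (j : ℝ) * ((j : ℝ) + 1))

/-- The lower bound `B(k,n)` (relative to the integer `s = s(k,n)`). -/
noncomputable def Bkn (k n s : ℕ) : ℝ :=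
  3 * rbinom2 ((k : ℝ) + 1) + 3 * rbinom2 ((k : ℝ) + 1 - (n : ℝ) / 3) +
    3 * ∑ j ∈ Finset.Icc 2 (s - 1), (j : ℝ) * ((j : ℝ) + 1) *
      rbinom2 ((k : ℝ) + 1 - cseq j * (n : ℝ))

/-- The number of ordered pairs in `W` that are strictly increasing under an injective map. -/
lemma card_filter_lt_product {α : Type*} [DecidableEq α] (W : Finset α) (f : α → ℕ)
    (hf : Function.Injective f) :
    ((W ×ˢ W).filter fun p => f p.1 < f p.2).card = W.card.choose 2 := by
  have hswap : ((W ×ˢ W).filter fun p => f p.2 < f p.1).card =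
      ((W ×ˢ W).filter fun p => f p.1 < f p.2).card := by
    refine Finset.card_nbij' Prod.swap Prod.swap ?_ ?_ ?_ ?_ <;>
      · rintro ⟨x, y⟩ h
        simp_all
  have hunion : W.offDiag = ((W ×ˢ W).filter fun p => f p.1 < f p.2) ∪
      ((W ×ˢ W).filter fun p => f p.2 < f p.1) := by
    ext ⟨x, y⟩
    simp only [Finset.mem_offDiag, Finset.mem_union, Finset.mem_filter, Finset.mem_product]
    have : x ≠ y ↔ f x < f y ∨ f y < f x := by rw [← hf.ne_iff, ne_iff_lt_or_gt]
    tauto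
  have hcard : W.offDiag.card = _ := congrArg Finset.card hunion
  rw [Finset.card_union_of_disjoint, hswap, Finset.offDiag_card] at hcard
  · rw [Nat.choose_two_right, Nat.mul_sub_one]
    omega
  · rw [Finset.disjoint_filter]
    intro p _ h
    omega

/-- Given class sizes `a 0, …, a (s - 1)`, there is a monotone labelling of the initial segment of
length `∑ a l` in which the label `l` is used exactly `a l` times. -/
lemma exists_monotone_labelling (a : ℕ → ℕ) (s : ℕ) :
    ∃ μ : ℕ → ℕ, (∀ i < ∑ l ∈ Finset.range s, a l, μ i < s) ∧
      (∀ i j, i ≤ j → j < ∑ l ∈ Finset.range s, a l → μ i ≤ μ j) ∧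
      (∑ i ∈ Finset.range (∑ l ∈ Finset.range s, a l), μ i = ∑ l ∈ Finset.range s, l * a l) ∧
      (∑ j ∈ Finset.range (∑ l ∈ Finset.range s, a l),
        ((Finset.range j).filter fun i => μ i = μ j).card =
          ∑ l ∈ Finset.range s, (a l).choose 2) := by
  induction s with
  | zero => exact ⟨fun _ => 0, by simp⟩
  | succ s ih =>
    obtain ⟨μ, hlt, hmono, hsum, hpairs⟩ := ih
    set M := ∑ l ∈ Finset.range s, a l with hM
    have hMs : ∑ l ∈ Finset.range (s + 1), a l = M + a s := Finset.sum_range_succ _ _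
    refine ⟨fun i => if i < M then μ i else s, ?_, ?_, ?_, ?_⟩
    · intro i _
      dsimp only
      split_ifs with h
      · exact (hlt i h).trans (Nat.lt_succ_self s)
      · exact Nat.lt_succ_self s
    · intro i j hij _
      dsimp only
      split_ifs with h1 h2 h2
      · exact hmono i j hij h2
      · exact (hlt i h1).le
      · omega
      · exact le_rfl
    · rw [hMs, Finset.sum_range_add, Finset.sum_range_succ, ← hsum]
      congr 1
      · exact Finset.sum_congr rfl fun i hi => if_pos (Finset.mem_range.1 hi)
      · simp [mul_comm]
    · rw [hMs, Finset.sum_range_add, Finset.sum_range_succ, ← hpairs]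
      congr 1
      · refine Finset.sum_congr rfl fun j hj => ?_
        have hj' := Finset.mem_range.1 hj
        congr 1
        refine Finset.filter_congr fun i hi => ?_
        dsimp only
        have hi' := Finset.mem_range.1 hi
        rw [if_pos hj', if_pos (hi'.trans hj')]
      · rw [Nat.choose_two_right, ← Finset.sum_range_id]
        refine Finset.sum_congr rfl fun r _ => ?_
        have hset : ((Finset.range (M + r)).filter fun i =>
            (if i < M then μ i else s) = if M + r < M then μ (M + r) else s) =
              Finset.Ico M (M + r) := by
          ext i
          simp only [Finset.mem_filter, Finset.mem_range, Finset.mem_Ico]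
          rw [if_neg (show ¬ M + r < M by omega)]
          split_ifs with hi
          · have := hlt i hi
            omega
          · omega
        rw [hset, Nat.card_Ico, Nat.add_sub_cancel_left]

namespace Halfperiod

variable {n : ℕ}

/-- The cyclic shift of a halfperiod: start at time `u` and, after the final ordering of `H`,
continue with the mirror images of the orderings of `H`. -/
def rotate (H : Halfperiod n) (u : ℕ) (hu : u ≤ n.choose 2) : Halfperiod n where
  pos t := if t + u ≤ n.choose 2 then H.pos (t + u)
    else (H.pos (t + u - n.choose 2)).trans Fin.revPerm
  move t := if t + u < n.choose 2 then H.move (t + u)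
    else n - 2 - H.move (t + u - n.choose 2)
  move_lt t ht := by
    split_ifs with h
    · exact H.move_lt _ h
    · have := H.move_lt (t + u - n.choose 2) (by omega)
      omega
  step t ht x := by
    have hx : ((H.pos (t + u - n.choose 2)) x : ℕ) < n := Fin.is_lt _
    rcases lt_trichotomy (t + u) (n.choose 2) with h | h | h
    · have hs := H.step (t + u) h x
      simp only [if_pos h, if_pos h.le, if_pos (show t + 1 + u ≤ n.choose 2 by omega)]
      rw [add_right_comm, hs]
    · have hs := H.step 0 (by omega) x
      have hm := H.move_lt 0 (by omega)
      have hr := H.reverse x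
      have e1 : t + 1 + u - n.choose 2 = 1 := by omega
      have e2 : t + u - n.choose 2 = 0 := by omega
      rw [e2] at hx
      rw [zero_add] at hs
      simp only [if_neg h.not_lt, if_pos h.le, if_neg (show ¬ t + 1 + u ≤ n.choose 2 by omega),
        e1, e2, Equiv.trans_apply, Fin.revPerm_apply, Fin.val_rev, hs]
      rw [h, hr]
      split_ifs <;> omega
    · have hs := H.step (t + u - n.choose 2) (by omega) x
      have hm := H.move_lt (t + u - n.choose 2) (by omega)
      have e1 : t + 1 + u - n.choose 2 = t + u - n.choose 2 + 1 := by omega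
      simp only [if_neg h.not_gt, if_neg h.not_ge,
        if_neg (show ¬ t + 1 + u ≤ n.choose 2 by omega),
        e1, Equiv.trans_apply, Fin.revPerm_apply, Fin.val_rev, hs]
      split_ifs <;> omega
  reverse x := by
    rw [zero_add, if_pos hu]
    have hx : ((H.pos u) x : ℕ) < n := Fin.is_lt _
    by_cases h : u = 0
    · subst h
      simpa using H.reverse x
    · rw [if_neg (by omega), Nat.add_sub_cancel_left]
      simp only [Equiv.trans_apply, Fin.revPerm_apply, Fin.val_rev]
      omega

/-- A set all of whose elements precede all other elements occupies the first positions. -/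
lemma mem_iff_pos_lt_card (H : Halfperiod n) (u : ℕ) (W : Finset (Fin n))
    (hW : ∀ x ∈ W, ∀ y ∉ W, H.pos u x < H.pos u y) (x : Fin n) :
    x ∈ W ↔ (H.pos u x : ℕ) < W.card := by
  have hcard : ∀ i : Fin n, (Finset.univ.filter fun y => H.pos u y < i).card = i := by
    intro i
    rw [← Fin.card_Iio i]
    refine Finset.card_nbij (H.pos u) ?_ (H.pos u).injective.injOn ?_
    · intro y hy
      simpa using hy
    · intro j hj
      exact ⟨(H.pos u).symm j, by simpa using hj, by simp⟩
  constructor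
  · intro hx
    rw [← hcard (H.pos u x)]
    refine Finset.card_lt_card ⟨fun y hy => ?_, fun h => ?_⟩
    · by_contra hyW
      exact lt_asymm (hW x hx y hyW) (Finset.mem_filter.1 hy).2
    · exact lt_irrefl _ (Finset.mem_filter.1 (h hx)).2
  · intro hx
    by_contra hxW
    have : W.card ≤ (H.pos u x : ℕ) := by
      rw [← hcard (H.pos u x)]
      exact Finset.card_le_card fun y hy =>
        Finset.mem_filter.2 ⟨Finset.mem_univ _, hW y hy x hxW⟩
    omega

variable [NeZero n]

/-- The element in position `move t` at time `t`. -/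
def lower (H : Halfperiod n) (t : ℕ) : Fin n := (H.pos t).symm (Fin.ofNat n (H.move t))

/-- The element in position `move t + 1` at time `t`. -/
def upper (H : Halfperiod n) (t : ℕ) : Fin n := (H.pos t).symm (Fin.ofNat n (H.move t + 1))

lemma lower_eq_iff (H : Halfperiod n) {t : ℕ} (ht : t < n.choose 2) (x : Fin n) :
    H.lower t = x ↔ (H.pos t x : ℕ) = H.move t := by
  have := H.move_lt t ht
  rw [lower, Equiv.symm_apply_eq, Fin.ext_iff, Fin.val_ofNat, Nat.mod_eq_of_lt (by omega), eq_comm]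

lemma upper_eq_iff (H : Halfperiod n) {t : ℕ} (ht : t < n.choose 2) (x : Fin n) :
    H.upper t = x ↔ (H.pos t x : ℕ) = H.move t + 1 := by
  have := H.move_lt t ht
  rw [upper, Equiv.symm_apply_eq, Fin.ext_iff, Fin.val_ofNat, Nat.mod_eq_of_lt (by omega), eq_comm]

lemma exists_lower_upper (H : Halfperiod n) {x y : Fin n} (h : H.pos 0 x < H.pos 0 y) :
    ∃ t < n.choose 2, H.lower t = x ∧ H.upper t = y := by
  by_contra! hno
  have key : ∀ t ≤ n.choose 2, H.pos t x < H.pos t y := by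
    intro t
    induction t with
    | zero => exact fun _ => h
    | succ t ih =>
      intro ht
      have hlt := ih (by omega)
      have h1 := H.step t ht x
      have h2 := H.step t ht y
      have h3 : ¬ ((H.pos t x : ℕ) = H.move t ∧ (H.pos t y : ℕ) = H.move t + 1) := by
        rintro ⟨hx, hy⟩
        exact hno t ht ((H.lower_eq_iff ht x).2 hx) ((H.upper_eq_iff ht y).2 hy)
      rw [Fin.lt_def] at hlt ⊢
      rw [h1, h2]
      split_ifs <;> omega
  have hN := key _ le_rfl
  have hy : (H.pos 0 y : ℕ) < n := Fin.is_lt _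
  rw [Fin.lt_def] at hN h
  rw [H.reverse, H.reverse] at hN
  omega

lemma image_lower_upper (H : Halfperiod n) :
    ((Finset.range (n.choose 2)).image fun t => (H.lower t, H.upper t)) =
      ((Finset.univ ×ˢ Finset.univ).filter
        fun p : Fin n × Fin n => (H.pos 0 p.1 : ℕ) < H.pos 0 p.2) := by
  symm
  apply Finset.eq_of_subset_of_card_le
  · rintro ⟨x, y⟩ hp
    obtain ⟨t, ht, hx, hy⟩ := H.exists_lower_upper (Fin.lt_def.2 (Finset.mem_filter.1 hp).2)
    exact Finset.mem_image.2 ⟨t, Finset.mem_range.2 ht, by rw [hx, hy]⟩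
  · rw [card_filter_lt_product Finset.univ (fun x => (H.pos 0 x : ℕ))
      (Fin.val_injective.comp (H.pos 0).injective), Finset.card_univ, Fintype.card_fin]
    exact Finset.card_image_le.trans_eq (Finset.card_range _)

lemma pos_zero_lower_lt (H : Halfperiod n) {t : ℕ} (ht : t < n.choose 2) :
    (H.pos 0 (H.lower t) : ℕ) < H.pos 0 (H.upper t) := by
  have : (H.lower t, H.upper t) ∈
      ((Finset.range (n.choose 2)).image fun t => (H.lower t, H.upper t)) :=
    Finset.mem_image_of_mem _ (Finset.mem_range.2 ht)
  rw [image_lower_upper] at this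
  exact (Finset.mem_filter.1 this).2

lemma injOn_lower_upper (H : Halfperiod n) :
    Set.InjOn (fun t => (H.lower t, H.upper t)) (Finset.range (n.choose 2)) := by
  rw [← Finset.card_image_iff, image_lower_upper,
    card_filter_lt_product Finset.univ (fun x => (H.pos 0 x : ℕ))
      (Fin.val_injective.comp (H.pos 0).injective), Finset.card_univ, Fintype.card_fin,
    Finset.card_range]

lemma card_filter_mem_mem (H : Halfperiod n) (W : Finset (Fin n)) :
    ((Finset.range (n.choose 2)).filter fun t => H.lower t ∈ W ∧ H.upper t ∈ W).card =
      W.card.choose 2 := by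
  rw [← card_filter_lt_product W (fun x => (H.pos 0 x : ℕ))
      (Fin.val_injective.comp (H.pos 0).injective)]
  refine Finset.card_nbij (fun t => (H.lower t, H.upper t)) ?_ ?_ ?_
  · intro t ht
    simp only [Finset.coe_filter, Finset.mem_range, Set.mem_ofPred_eq, Finset.mem_product] at ht ⊢
    exact ⟨ht.2, H.pos_zero_lower_lt ht.1⟩
  · exact H.injOn_lower_upper.mono (Finset.coe_subset.2 (Finset.filter_subset _ _))
  · rintro ⟨x, y⟩ hp
    simp only [Finset.coe_filter, Set.mem_ofPred_eq, Finset.mem_product] at hp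
    obtain ⟨t, ht, rfl, rfl⟩ := H.exists_lower_upper (Fin.lt_def.2 hp.2)
    exact ⟨t, by simpa using ⟨ht, hp.1⟩, rfl⟩

open Classical in
/-- The `(≤ k)`-critical steps at which two elements of `W` are exchanged. -/
noncomputable def critSteps (H : Halfperiod n) (k : ℕ) (W : Finset (Fin n)) : Finset ℕ :=
  (Finset.range (n.choose 2)).filter fun t => H.CritAt k t ∧ H.lower t ∈ W ∧ H.upper t ∈ W

open Classical in
/-- The steps that are not `(≤ k)`-critical and at which two elements of `W` are exchanged. -/
noncomputable def centerSteps (H : Halfperiod n) (k : ℕ) (W : Finset (Fin n)) : Finset ℕ :=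
  (Finset.range (n.choose 2)).filter fun t => ¬ H.CritAt k t ∧ H.lower t ∈ W ∧ H.upper t ∈ W

lemma card_critSteps_add_card_centerSteps (H : Halfperiod n) (k : ℕ) (W : Finset (Fin n)) :
    (H.critSteps k W).card + (H.centerSteps k W).card = W.card.choose 2 := by
  classical
  rw [← H.card_filter_mem_mem W, critSteps, centerSteps,
    ← Finset.card_filter_add_card_filter_not (s := (Finset.range (n.choose 2)).filter
      fun t => H.lower t ∈ W ∧ H.upper t ∈ W) (fun t => H.CritAt k t),
    Finset.filter_filter, Finset.filter_filter]
  simp only [and_comm]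

lemma card_critSteps_rotate_le (H : Halfperiod n) (u : ℕ) (hu : u ≤ n.choose 2) (k : ℕ)
    (W : Finset (Fin n)) :
    ((H.rotate u hu).critSteps k W).card ≤ (H.critSteps k W).card := by
  refine Finset.card_le_card_of_injOn
    (fun t => if t + u < n.choose 2 then t + u else t + u - n.choose 2) ?_ ?_
  · intro t ht
    simp only [critSteps, Finset.coe_filter, Finset.mem_range, Set.mem_ofPred_eq] at ht ⊢
    obtain ⟨htN, hcrit, hl, hr⟩ := ht
    have hm := (H.rotate u hu).move_lt t htN
    have el := ((H.rotate u hu).lower_eq_iff htN _).1 rfl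
    have er := ((H.rotate u hu).upper_eq_iff htN _).1 rfl
    generalize (H.rotate u hu).lower t = x at *
    generalize (H.rotate u hu).upper t = y at *
    simp only [CritAt] at hcrit ⊢
    simp only [rotate] at hcrit hm el er
    split_ifs with h
    · rw [if_pos h] at hcrit el er
      rw [if_pos h.le] at el er
      rw [(H.lower_eq_iff h x).2 el, (H.upper_eq_iff h y).2 er]
      exact ⟨h, hcrit, hl, hr⟩
    · have h' : t + u - n.choose 2 < n.choose 2 := by omega
      have hm' := H.move_lt _ h'
      rw [if_neg h] at hcrit hm el er
      have hval : ∀ z : Fin n, (((if t + u ≤ n.choose 2 then H.pos (t + u)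
          else (H.pos (t + u - n.choose 2)).trans Fin.revPerm) z : Fin n) : ℕ) =
            n - 1 - H.pos (t + u - n.choose 2) z := by
        intro z
        split_ifs with h1
        · have : t + u = n.choose 2 := by omega
          rw [this, Nat.sub_self, H.reverse]
        · simp only [Equiv.trans_apply, Fin.revPerm_apply, Fin.val_rev]
          omega
      rw [hval] at el er
      have hx : (H.pos (t + u - n.choose 2) x : ℕ) < n := Fin.is_lt _
      have hy : (H.pos (t + u - n.choose 2) y : ℕ) < n := Fin.is_lt _
      rw [(H.lower_eq_iff h' y).2 (by omega), (H.upper_eq_iff h' x).2 (by omega)]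
      exact ⟨h', by omega, hr, hl⟩
  · intro t ht t' ht' h
    simp only [critSteps, Finset.coe_filter, Finset.mem_range, Set.mem_ofPred_eq] at ht ht' h
    split_ifs at h <;> omega

open Classical in
/-- Each element crosses the center, made of the positions `k, …, n - k - 1`, exactly once; the
clamped position increases (decreases) by one when it is the lower (upper) element of a
non-critical transposition. -/
lemma clamp_step (H : Halfperiod n) {k : ℕ} (hk : 2 * k < n) {t : ℕ} (ht : t < n.choose 2)
    (x : Fin n) :
    max (k : ℤ) (min ((H.pos (t + 1) x : ℕ) : ℤ) ((n : ℤ) - k - 1)) -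
        max (k : ℤ) (min ((H.pos t x : ℕ) : ℤ) ((n : ℤ) - k - 1)) =
      if H.CritAt k t then 0
      else (if H.lower t = x then 1 else 0) - if H.upper t = x then 1 else 0 := by
  have hm := H.move_lt t ht
  have hx : (H.pos t x : ℕ) < n := Fin.is_lt _
  rw [H.step t ht x]
  simp only [H.lower_eq_iff ht, H.upper_eq_iff ht, CritAt]
  split_ifs <;> omega

open Classical in
lemma sum_center_eq (H : Halfperiod n) {k : ℕ} (hk : 2 * k < n) (x : Fin n)
    (hx : (H.pos 0 x : ℕ) < k) :
    ∑ t ∈ (Finset.range (n.choose 2)).filter fun t => ¬ H.CritAt k t,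
      ((if H.lower t = x then 1 else 0) - if H.upper t = x then 1 else 0 : ℤ) =
        (n : ℤ) - 2 * k - 1 := by
  have h := Finset.sum_range_sub
    (fun t => max (k : ℤ) (min ((H.pos t x : ℕ) : ℤ) ((n : ℤ) - k - 1))) (n.choose 2)
  rw [Finset.sum_congr rfl fun t ht => H.clamp_step hk (Finset.mem_range.1 ht) x] at h
  rw [Finset.sum_filter]
  simp only [ite_not]
  rw [h, H.reverse]
  omega

/-- The number of exchanges inside `W` taking place in the center is bounded through any
monotone labelling `μ` of the elements of `W`. -/
lemma card_centerSteps_le (H : Halfperiod n) {k : ℕ} (hk : 2 * k < n) (W : Finset (Fin n))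
    (hW : ∀ x, x ∈ W ↔ (H.pos 0 x : ℕ) < W.card) (hWk : W.card ≤ k) (μ : ℕ → ℕ)
    (hμ : ∀ i j, i ≤ j → j < W.card → μ i ≤ μ j) :
    ((H.centerSteps k W).card : ℤ) ≤
      ((n : ℤ) - 2 * k - 1) * (∑ i ∈ Finset.range W.card, μ i : ℕ) +
        (∑ j ∈ Finset.range W.card,
          ((Finset.range j).filter fun i => μ i = μ j).card : ℕ) := by
  classical
  set m := W.card with hm
  set r : Fin n → ℕ := fun x => m - 1 - H.pos 0 x with hr
  have hsumW : ∑ x ∈ W, μ (r x) = ∑ i ∈ Finset.range m, μ i := by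
    have hinj : Set.InjOn r W := by
      intro x hx y hy hxy
      have h1 := (hW x).1 hx
      have h2 := (hW y).1 hy
      simp only [hr] at hxy
      exact (H.pos 0).injective (Fin.ext (by omega))
    rw [← Finset.sum_image hinj]
    congr 1
    refine Finset.eq_of_subset_of_card_le ?_ ?_
    · intro i hi
      obtain ⟨x, hx, rfl⟩ := Finset.mem_image.1 hi
      have h1 := (hW x).1 hx
      simp only [hr, Finset.mem_range]
      omega
    · rw [Finset.card_range, Finset.card_image_of_injOn hinj]
  have hsame : ((H.centerSteps k W).filter
      fun t => μ (r (H.lower t)) = μ (r (H.upper t))).card ≤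
        ∑ j ∈ Finset.range m, ((Finset.range j).filter fun i => μ i = μ j).card := by
    rw [← Finset.card_sigma]
    refine Finset.card_le_card_of_injOn
      (fun t => (⟨r (H.lower t), r (H.upper t)⟩ : Σ _ : ℕ, ℕ)) ?_ ?_
    · intro t ht
      simp only [centerSteps, Finset.coe_filter, Finset.mem_filter, Finset.mem_range,
        Set.mem_ofPred_eq] at ht
      obtain ⟨⟨htN, -, hl, hu⟩, heq⟩ := ht
      have h1 := (hW _).1 hl
      have h2 := (hW _).1 hu
      have h3 := H.pos_zero_lower_lt htN
      simp only [Finset.coe_sigma, Set.mem_sigma_iff, Finset.mem_coe, Finset.mem_range,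
        Finset.mem_filter]
      refine ⟨?_, ?_, heq.symm⟩ <;> simp only [hr] <;> omega
    · intro t ht t' ht' h
      simp only [centerSteps, Finset.coe_filter, Finset.mem_filter, Finset.mem_range,
        Set.mem_ofPred_eq] at ht ht'
      obtain ⟨⟨htN, -, hl, hu⟩, -⟩ := ht
      obtain ⟨⟨htN', -, hl', hu'⟩, -⟩ := ht'
      have h1 := (hW _).1 hl
      have h2 := (hW _).1 hu
      have h1' := (hW _).1 hl'
      have h2' := (hW _).1 hu'
      simp only [hr, Sigma.mk.injEq, heq_eq_eq] at h
      refine H.injOn_lower_upper (Finset.mem_coe.2 (Finset.mem_range.2 htN))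
        (Finset.mem_coe.2 (Finset.mem_range.2 htN')) (Prod.ext ?_ ?_)
      · exact (H.pos 0).injective (Fin.ext (by dsimp only; omega))
      · exact (H.pos 0).injective (Fin.ext (by dsimp only; omega))
  have hflow : ∑ x ∈ W, (μ (r x) : ℤ) * ((n : ℤ) - 2 * k - 1) =
      ∑ t ∈ (Finset.range (n.choose 2)).filter fun t => ¬ H.CritAt k t,
        ((if H.lower t ∈ W then (μ (r (H.lower t)) : ℤ) else 0) -
          if H.upper t ∈ W then (μ (r (H.upper t)) : ℤ) else 0) := by
    rw [Finset.sum_congr rfl fun x hx => by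
      rw [← H.sum_center_eq hk x (((hW x).1 hx).trans_le hWk)]]
    simp only [Finset.mul_sum, mul_sub, mul_ite, mul_one, mul_zero]
    rw [Finset.sum_comm]
    simp only [Finset.sum_sub_distrib, Finset.sum_ite_eq]
  have hle : ((H.centerSteps k W).card : ℤ) - ((H.centerSteps k W).filter
      fun t => μ (r (H.lower t)) = μ (r (H.upper t))).card ≤
      ∑ x ∈ W, (μ (r x) : ℤ) * ((n : ℤ) - 2 * k - 1) := by
    rw [hflow, Finset.card_filter, centerSteps, ← Finset.filter_filter, Finset.card_filter,
      Finset.sum_filter (p := fun t => H.lower t ∈ W ∧ H.upper t ∈ W)]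
    push_cast
    rw [← Finset.sum_sub_distrib]
    refine Finset.sum_le_sum fun t ht => ?_
    have htN := Finset.mem_range.1 (Finset.mem_filter.1 ht).1
    have h3 := H.pos_zero_lower_lt htN
    by_cases hu : H.upper t ∈ W
    · have hu' := (hW _).1 hu
      have hl : H.lower t ∈ W := (hW _).2 (h3.trans hu')
      have hl' := (hW _).1 hl
      have := hμ (r (H.upper t)) (r (H.lower t)) (by simp only [hr]; omega)
        (by simp only [hr]; omega)
      simp only [hl, hu, and_self, if_true]
      split_ifs <;> omega
    · simp only [hu, and_false, if_false]
      split_ifs <;> omega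
  rw [← Finset.sum_mul, ← Nat.cast_sum, hsumW] at hle
  have : ((((H.centerSteps k W).filter
      fun t => μ (r (H.lower t)) = μ (r (H.upper t))).card : ℕ) : ℤ) ≤ _ :=
    Nat.cast_le.2 hsame
  linarith [mul_comm ((n : ℤ) - 2 * k - 1) (∑ i ∈ Finset.range m, μ i : ℕ)]

end Halfperiod

/-- The nearly arithmetic class sizes that minimize the bound of
`Halfperiod.card_centerSteps_le` for `s` classes, and the resulting value. -/
lemma exists_class_sizes (m w s : ℕ) (hs : 1 ≤ s) (h : w * s.choose 2 ≤ m) :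
    ∃ a : ℕ → ℕ, ∑ l ∈ Finset.range s, a l = m ∧
      2 * ((w : ℝ) * (∑ l ∈ Finset.range s, l * a l : ℕ) +
        (∑ l ∈ Finset.range s, (a l).choose 2 : ℕ)) ≤
      (m : ℝ) ^ 2 / s - m + m * w * (s - 1) - ((w : ℝ) ^ 2 - 1) * ((s : ℝ) ^ 3 - s) / 12 := by
  set T := m + w * s.choose 2 with hT
  set b := T / s with hb
  set q := T % s with hq
  have hTb : s * b + q = T := Nat.div_add_mod T s
  have hqs : q < s := Nat.mod_lt _ hs
  have hchoose : 2 * s.choose 2 = s * (s - 1) := by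
    rw [Nat.choose_two_right, Nat.mul_div_cancel' (Nat.even_mul_pred_self s).two_dvd]
  have hbw : w * (s - 1) ≤ b := by
    rw [hb, Nat.le_div_iff_mul_le hs, hT]
    calc w * (s - 1) * s = w * (2 * s.choose 2) := by rw [hchoose]; ring
      _ ≤ _ := by linarith
  have hsub : ∀ l ∈ Finset.range s, w * l ≤ b + if l < q then 1 else 0 := fun l hl =>
    ((Nat.mul_le_mul_left w (Nat.le_sub_one_of_lt (Finset.mem_range.1 hl))).trans hbw).trans
      (Nat.le_add_right _ _)
  have hsq : (Finset.range s).filter (· < q) = Finset.range q := by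
    ext i
    simp only [Finset.mem_filter, Finset.mem_range]
    omega
  have hind : ∑ l ∈ Finset.range s, (if l < q then 1 else 0 : ℝ) = q := by
    rw [Finset.sum_boole, hsq, Finset.card_range]
  have hid : ∀ p : ℕ, ∑ l ∈ Finset.range p, (l : ℝ) = p * (p - 1) / 2 := by
    intro p
    induction p with
    | zero => simp
    | succ p ih => rw [Finset.sum_range_succ, ih]; push_cast; ring
  have hid2 : ∀ p : ℕ, ∑ l ∈ Finset.range p, (l : ℝ) ^ 2 = p * (p - 1) * (2 * p - 1) / 6 := by
    intro p
    induction p with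
    | zero => simp
    | succ p ih => rw [Finset.sum_range_succ, ih]; push_cast; ring
  have hTR : (s : ℝ) * b + q = m + w * (s * (s - 1) / 2) := by
    have h1 : ((s * b + q : ℕ) : ℝ) = (m + w * s.choose 2 : ℕ) := by rw [hTb]
    push_cast [Nat.cast_choose_two] at h1
    exact h1
  have hsum : (∑ l ∈ Finset.range s, ((b : ℝ) + (if l < q then 1 else 0) - w * l)) = m := by
    rw [Finset.sum_sub_distrib, Finset.sum_add_distrib, hind, ← Finset.mul_sum, hid,
      Finset.sum_const, Finset.card_range, nsmul_eq_mul, hTR]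
    ring
  have hcast : ∀ l ∈ Finset.range s, ((b + (if l < q then 1 else 0) - w * l : ℕ) : ℝ) =
      (b : ℝ) + (if l < q then 1 else 0) - w * l := by
    intro l hl
    rw [Nat.cast_sub (hsub l hl)]
    push_cast
    rfl
  refine ⟨fun l => b + (if l < q then 1 else 0) - w * l, ?_, ?_⟩
  · have : ((∑ l ∈ Finset.range s, (b + (if l < q then 1 else 0) - w * l) : ℕ) : ℝ) = m := by
      rw [Nat.cast_sum, Finset.sum_congr rfl hcast, hsum]
    exact_mod_cast this
  · have hcost : 2 * ((w : ℝ) *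
        (∑ l ∈ Finset.range s, l * (b + (if l < q then 1 else 0) - w * l) : ℕ) +
        (∑ l ∈ Finset.range s, (b + (if l < q then 1 else 0) - w * l).choose 2 : ℕ)) =
        s * (b : ℝ) ^ 2 + (2 * b + 1) * q - w ^ 2 * (s * (s - 1) * (2 * s - 1) / 6) - m := by
      rw [← hid2, ← hsum]
      push_cast [Nat.cast_choose_two]
      rw [Finset.mul_sum, ← Finset.sum_add_distrib, Finset.mul_sum]
      rw [Finset.mul_sum, show (s : ℝ) * (b : ℝ) ^ 2 = ∑ l ∈ Finset.range s, (b : ℝ) ^ 2 by simp,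
        ← hind, Finset.mul_sum, ← Finset.sum_add_distrib, ← Finset.sum_sub_distrib,
        ← Finset.sum_sub_distrib]
      refine Finset.sum_congr rfl fun l hl => ?_
      rw [hcast l hl]
      split_ifs <;> ring
    rw [hcost]
    have hs0 : (0 : ℝ) < s := by exact_mod_cast hs
    have hround : (q : ℝ) * (s - q) ≤ s ^ 2 * (s ^ 2 - 1) / 12 := by
      rcases hs.eq_or_lt with h1 | h1
      · have hq0 : q = 0 := by omega
        rw [hq0, ← h1]
        norm_num
      · have h2 : (2 : ℝ) ≤ s := by exact_mod_cast h1
        nlinarith [sq_nonneg ((s : ℝ) - 2 * q), sq_nonneg (s : ℝ),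
          mul_nonneg (sq_nonneg (s : ℝ)) (by nlinarith : (0 : ℝ) ≤ s ^ 2 - 4)]
    have hm : (m : ℝ) = s * b + q - w * (s * (s - 1) / 2) := by linarith
    rw [← sub_nonneg]
    have : (m : ℝ) ^ 2 / s - m + m * w * (s - 1) - ((w : ℝ) ^ 2 - 1) * ((s : ℝ) ^ 3 - s) / 12 -
        (s * (b : ℝ) ^ 2 + (2 * b + 1) * q - w ^ 2 * (s * (s - 1) * (2 * s - 1) / 6) - m) =
        (s ^ 2 * (s ^ 2 - 1) / 12 - q * (s - q)) / s := by
      rw [hm]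
      field_simp
      ring
    rw [this]
    exact div_nonneg (by linarith) hs0.le

/-- Since the arguments decrease, truncating the binomials only removes a tail of the sum. -/
lemma exists_sum_rbinom2_eq (c r : ℕ → ℝ) (hr : Antitone r) (p : ℕ) :
    ∃ p' ≤ p, ∑ j ∈ Finset.range p, c j * rbinom2 (r j) =
      ∑ j ∈ Finset.range p', c j * (r j * (r j - 1) / 2) := by
  induction p with
  | zero => exact ⟨0, le_rfl, by simp⟩
  | succ p ih =>
    by_cases h : 2 ≤ r p
    · refine ⟨p + 1, le_rfl, Finset.sum_congr rfl fun j hj => ?_⟩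
      rw [rbinom2, if_pos (h.trans (hr (Nat.lt_succ_iff.1 (Finset.mem_range.1 hj))))]
    · obtain ⟨p', hp', heq⟩ := ih
      refine ⟨p', hp'.trans (Nat.le_succ p), ?_⟩
      rw [Finset.sum_range_succ, rbinom2, if_neg h, mul_zero, add_zero, heq]

lemma antitone_sub_cseq_mul (x : ℝ) (n : ℕ) :
    Antitone fun j : ℕ => x - cseq (j + 1) * (n : ℝ) := by
  refine antitone_nat_of_succ_le fun j => ?_
  have : cseq (j + 1) ≤ cseq (j + 1 + 1) := by
    simp only [cseq]
    push_cast
    gcongr <;> linarith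
  have := mul_le_mul_of_nonneg_right this (Nat.cast_nonneg (α := ℝ) n)
  linarith

lemma sum_cseq_eq (m n k p : ℕ) (hn : 3 * m = n) :
    ∑ j ∈ Finset.range p, ((j + 1 : ℕ) : ℝ) * (((j + 1 : ℕ) : ℝ) + 1) *
      (((k : ℝ) + 1 - cseq (j + 1) * n) * ((k : ℝ) + 1 - cseq (j + 1) * n - 1) / 2) =
    ((m : ℝ) ^ 2 * (1 - 1 / (p + 1)) - m * ((n : ℝ) - 2 * k - 1) * p +
      (((n : ℝ) - 2 * k - 1) ^ 2 - 1) * (((p : ℝ) + 1) ^ 3 - (p + 1)) / 12) / 2 := by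
  subst hn
  induction p with
  | zero => simp
  | succ p ih =>
    rw [Finset.sum_range_succ, ih, cseq]
    push_cast
    have h1 : (p : ℝ) + 1 ≠ 0 := by positivity
    have h2 : (p : ℝ) + 1 + 1 ≠ 0 := by positivity
    field_simp
    ring

/-- Lower bound for the number of critical exchanges within a wing that initially occupies the
first third of the positions. -/
lemma Halfperiod.sum_le_card_critSteps {n : ℕ} [NeZero n] (H : Halfperiod n) {k : ℕ}
    (hk : 2 * k < n) (W : Finset (Fin n)) (hn : 3 * W.card = n) (hWk : W.card ≤ k)
    (hW : ∀ x, x ∈ W ↔ (H.pos 0 x : ℕ) < W.card) (p : ℕ)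
    (hp : (n - 2 * k - 1) * (p + 1).choose 2 ≤ W.card) :
    ∑ j ∈ Finset.range p, ((j + 1 : ℕ) : ℝ) * (((j + 1 : ℕ) : ℝ) + 1) *
      rbinom2 ((k : ℝ) + 1 - cseq (j + 1) * n) ≤ ((H.critSteps k W).card : ℝ) := by
  obtain ⟨p', hp', heq⟩ := exists_sum_rbinom2_eq
    (fun j => ((j + 1 : ℕ) : ℝ) * (((j + 1 : ℕ) : ℝ) + 1)) _
    (antitone_sub_cseq_mul ((k : ℝ) + 1) n) p
  rw [heq, sum_cseq_eq W.card n k p' hn]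
  obtain ⟨a, hsum, ha⟩ := exists_class_sizes W.card (n - 2 * k - 1) (p' + 1) (by omega)
    ((Nat.mul_le_mul_left _ (Nat.choose_le_choose 2 (by omega))).trans hp)
  obtain ⟨μ, -, hmono, h1, h2⟩ := exists_monotone_labelling a (p' + 1)
  rw [hsum] at hmono h1 h2
  have hc := H.card_centerSteps_le hk W hW hWk μ hmono
  rw [h1, h2] at hc
  have hc' : ((H.centerSteps k W).card : ℝ) ≤ ((n : ℝ) - 2 * k - 1) *
      (∑ l ∈ Finset.range (p' + 1), l * a l : ℕ) +
        (∑ l ∈ Finset.range (p' + 1), (a l).choose 2 : ℕ) := by exact_mod_cast hc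
  have hw : ((n - 2 * k - 1 : ℕ) : ℝ) = (n : ℝ) - 2 * k - 1 := by
    rw [Nat.sub_sub, Nat.cast_sub (by omega)]
    push_cast
    ring
  have htot : ((H.critSteps k W).card : ℝ) + (H.centerSteps k W).card =
      W.card * (W.card - 1) / 2 := by
    rw [← Nat.cast_choose_two, ← H.card_critSteps_add_card_centerSteps k W]
    push_cast
    rfl
  rw [hw] at ha
  push_cast at ha hc'
  have : (W.card : ℝ) ^ 2 * (1 - 1 / ((p' : ℝ) + 1)) =
      W.card ^ 2 - W.card ^ 2 / ((p' : ℝ) + 1) := by ring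
  rw [this]
  linarith

lemma Halfperiod.sum_card_critSteps_le {n : ℕ} [NeZero n] (H : Halfperiod n) (k : ℕ)
    {A B C : Finset (Fin n)} (hAB : Disjoint A B) (hAC : Disjoint A C) (hBC : Disjoint B C) :
    (H.critSteps k A).card + (H.critSteps k B).card + (H.critSteps k C).card ≤
      NcritMono n k H A B C := by
  classical
  rw [← Finset.card_union_of_disjoint, ← Finset.card_union_of_disjoint, NcritMono,
    ← Set.ncard_coe_finset]
  · refine Set.ncard_le_ncard ?_
      ((Set.finite_lt_nat (n.choose 2)).subset fun t ht => ht.1)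
    intro t ht
    simp only [critSteps, Finset.coe_union, Finset.coe_filter, Finset.mem_range, Set.mem_union,
      Set.mem_ofPred_eq] at ht
    have htN : t < n.choose 2 := by tauto
    refine ⟨htN, by rcases ht with (h | h) | h <;> exact h.2.1, fun x y hx hy => ?_⟩
    rw [← (H.lower_eq_iff htN x).2 hx, ← (H.upper_eq_iff htN y).2 hy]
    exact or_assoc.1 (ht.imp (Or.imp (fun h => h.2.2) fun h => h.2.2) fun h => h.2.2)
  · rw [Finset.disjoint_left]
    intro t ht ht'
    simp only [critSteps, Finset.mem_union, Finset.mem_filter] at ht ht'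
    rcases ht with ht | ht
    · exact Finset.disjoint_left.1 hAC ht.2.2.1 ht'.2.2.1
    · exact Finset.disjoint_left.1 hBC ht.2.2.1 ht'.2.2.1
  · rw [Finset.disjoint_left]
    intro t ht ht'
    simp only [critSteps, Finset.mem_filter] at ht ht'
    exact Finset.disjoint_left.1 hAB ht.2.2.1 ht'.2.2.1

/-- `Halfperiod.sum_le_card_critSteps` for a wing that occupies the first third of the positions
at some time `u`. -/
lemma Halfperiod.sum_le_card_critSteps_of_first {n : ℕ} [NeZero n] (H : Halfperiod n) {k : ℕ}
    (hk : 2 * k < n) (W : Finset (Fin n)) (hn : 3 * W.card = n) (hWk : W.card ≤ k)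
    (u : ℕ) (hu : u ≤ n.choose 2) (hW : ∀ x ∈ W, ∀ y ∉ W, H.pos u x < H.pos u y) (p : ℕ)
    (hp : (n - 2 * k - 1) * (p + 1).choose 2 ≤ W.card) :
    ∑ j ∈ Finset.range p, ((j + 1 : ℕ) : ℝ) * (((j + 1 : ℕ) : ℝ) + 1) *
      rbinom2 ((k : ℝ) + 1 - cseq (j + 1) * n) ≤ ((H.critSteps k W).card : ℝ) := by
  have hpos : (H.rotate u hu).pos 0 = H.pos u := by
    simp only [rotate, zero_add, if_pos hu]
  refine ((H.rotate u hu).sum_le_card_critSteps hk W hn hWk ?_ p hp).trans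
    (Nat.cast_le.2 (H.card_critSteps_rotate_le u hu k W))
  rw [hpos]
  exact H.mem_iff_pos_lt_card u W hW

/-- For a 3-decomposable halfperiod on `n` points (with `3 ∣ n`) and `n/3 < k < n/2`, the number
of monochromatic `(≤ k)`-critical transpositions is at least
`B(k,n) − 3·binom(n/3+1,2) − (k − n/3)·n`. -/
theorem NcritMono_of_threeDecomposable_ge (n k s : ℕ) (hn : 0 < n) (h3 : 3 ∣ n)
    (hk1 : n / 3 < k) (hk2 : 2 * k < n)
    (hs : 0 < s ∧ rbinom2 (s : ℝ) < (n : ℝ) / (3 * ((n : ℝ) - 2 * k - 1)) ∧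
      (n : ℝ) / (3 * ((n : ℝ) - 2 * k - 1)) ≤ rbinom2 ((s : ℝ) + 1))
    (H : Halfperiod n) (A B C : Finset (Fin n)) (hdec : H.ThreeDecomp A B C) :
    Bkn k n s - 3 * rbinom2 ((n : ℝ) / 3 + 1) - ((k : ℝ) - (n : ℝ) / 3) * (n : ℝ)
      ≤ (NcritMono n k H A B C : ℝ) := by
  obtain ⟨hs0, hs1, hs2⟩ := hs
  obtain ⟨hA, hB, hC, hAB, hAC, hBC, huniv, h0AB, h0BC, u, t, -, hut, htN, huBA, huAC, -, -⟩ :=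
    hdec
  have : NeZero n := ⟨hn.ne'⟩
  obtain ⟨m, rfl⟩ := h3
  have hmA : A.card = m := by omega
  have hmB : B.card = m := by omega
  have hmC : C.card = m := by omega
  have hmk : m < k := by omega
  have hm0 : 0 < m := by omega
  have hm1 : (1 : ℝ) ≤ m := by exact_mod_cast hm0
  have hmkR : (m : ℝ) + 1 ≤ k := by exact_mod_cast hmk
  have hmem : ∀ x : Fin (3 * m), x ∈ A ∨ x ∈ B ∨ x ∈ C := by
    intro x
    have := Finset.mem_univ x
    rw [← huniv, Finset.mem_union, Finset.mem_union] at this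
    tauto
  have hw0 : (0 : ℝ) < ((3 * m : ℕ) : ℝ) - 2 * k - 1 := by
    have h1 : ((2 * k + 1 : ℕ) : ℝ) ≤ (3 * m : ℕ) := Nat.cast_le.2 (by omega)
    push_cast at h1 ⊢
    refine lt_of_le_of_ne (by linarith) fun h => ?_
    push_cast at hs1
    rw [← h, mul_zero, div_zero, rbinom2] at hs1
    split_ifs at hs1 with h2
    · nlinarith
    · exact lt_irrefl _ hs1
  obtain ⟨p, rfl⟩ : ∃ p, s = p + 1 := ⟨s - 1, by omega⟩
  have hp : (3 * m - 2 * k - 1) * (p + 1).choose 2 ≤ m := by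
    have hr : rbinom2 ((p + 1 : ℕ) : ℝ) = ((p + 1).choose 2 : ℕ) := by
      rw [rbinom2, Nat.cast_choose_two]
      split_ifs with h
      · rfl
      · have hp0 : p = 0 := by
          by_contra hp0
          exact h (by exact_mod_cast (by omega : 2 ≤ p + 1))
        simp [hp0]
    have h1 : ((3 * m - 2 * k - 1 : ℕ) : ℝ) = ((3 * m : ℕ) : ℝ) - 2 * k - 1 := by
      rw [Nat.sub_sub, Nat.cast_sub (by omega)]
      push_cast
      ring
    rw [hr, lt_div_iff₀ (by positivity)] at hs1
    have h2 : (((3 * m - 2 * k - 1) * (p + 1).choose 2 : ℕ) : ℝ) ≤ m := by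
      rw [Nat.cast_mul, h1]
      push_cast at hs1 ⊢
      linarith
    exact_mod_cast h2
  have hp1 : 1 ≤ p := by
    by_contra hp1
    have hp0 : p = 0 := by omega
    rw [hp0, div_le_iff₀ (by positivity), rbinom2, if_pos (by norm_num)] at hs2
    push_cast at hs2
    linarith
  set S := ∑ j ∈ Finset.range p, ((j + 1 : ℕ) : ℝ) * (((j + 1 : ℕ) : ℝ) + 1) *
      rbinom2 ((k : ℝ) + 1 - cseq (j + 1) * (3 * m : ℕ)) with hS
  have hSA : S ≤ ((H.critSteps k A).card : ℝ) := by
    refine H.sum_le_card_critSteps_of_first hk2 A hA (by omega) 0 (Nat.zero_le _) ?_ p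
      (by rw [hmA]; exact hp)
    intro x hx y hy
    rcases hmem y with h | h | h
    · exact absurd h hy
    · exact h0AB x hx y h
    · obtain ⟨b, hb⟩ : B.Nonempty := Finset.card_pos.1 (by omega)
      exact (h0AB x hx b hb).trans (h0BC b hb y h)
  have hSB : S ≤ ((H.critSteps k B).card : ℝ) := by
    refine H.sum_le_card_critSteps_of_first hk2 B hB (by omega) (u + 1) (by omega) ?_ p
      (by rw [hmB]; exact hp)
    intro x hx y hy
    rcases hmem y with h | h | h
    · exact huBA x hx y h
    · exact absurd h hy
    · obtain ⟨a, ha⟩ : A.Nonempty := Finset.card_pos.1 (by omega)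
      exact (huBA x hx a ha).trans (huAC a ha y h)
  have hSC : S ≤ ((H.critSteps k C).card : ℝ) := by
    refine H.sum_le_card_critSteps_of_first hk2 C hC (by omega) _ le_rfl ?_ p
      (by rw [hmC]; exact hp)
    intro x hx y hy
    have hyx : H.pos 0 y < H.pos 0 x := by
      rcases hmem y with h | h | h
      · obtain ⟨b, hb⟩ : B.Nonempty := Finset.card_pos.1 (by omega)
        exact (h0AB y h b hb).trans (h0BC b hb x hx)
      · exact h0BC y h x hx
      · exact absurd h hy
    rw [Fin.lt_def] at hyx ⊢
    rw [H.reverse, H.reverse]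
    have := (H.pos 0 x).is_lt
    omega
  have htotal : ((H.critSteps k A).card : ℝ) + (H.critSteps k B).card + (H.critSteps k C).card ≤
      (NcritMono (3 * m) k H A B C : ℝ) := by
    exact_mod_cast H.sum_card_critSteps_le k hAB hAC hBC
  have hSeq : S = (k + 1 - m) * (k + 1 - m - 1) + ∑ j ∈ Finset.Icc 2 p, (j : ℝ) * ((j : ℝ) + 1) *
      rbinom2 ((k : ℝ) + 1 - cseq j * (3 * m : ℕ)) := by
    rw [hS, Finset.sum_range_eq_add_Ico _ hp1, Finset.sum_Ico_add'
      (fun j : ℕ => (j : ℝ) * ((j : ℝ) + 1) * rbinom2 ((k : ℝ) + 1 - cseq j * (3 * m : ℕ)))]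
    congr 1
    have hc : (k : ℝ) + 1 - cseq (0 + 1) * (3 * m : ℕ) = k + 1 - m := by
      rw [cseq]
      push_cast
      ring
    rw [hc, rbinom2, if_pos (by linarith)]
    push_cast
    ring
  have hB' : Bkn k (3 * m) (p + 1) = 3 * ((k + 1) * k / 2) +
      3 * ((k + 1 - m) * (k + 1 - m - 1) / 2) + 3 * ∑ j ∈ Finset.Icc 2 p,
        (j : ℝ) * ((j : ℝ) + 1) * rbinom2 ((k : ℝ) + 1 - cseq j * (3 * m : ℕ)) := by
    have hdiv : ((3 * m : ℕ) : ℝ) / 3 = m := by push_cast; ring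
    rw [Bkn, hdiv, Nat.add_sub_cancel, rbinom2, if_pos (by linarith), rbinom2,
      if_pos (by linarith)]
    ring
  have hdiv : ((3 * m : ℕ) : ℝ) / 3 = m := by push_cast; ring
  rw [hB', hdiv, rbinom2, if_pos (by linarith)]
  push_cast at hSeq ⊢
  linarith
end

section
/- Let n be a positive integer divisible by 3 and let k be an integer with n/3 < k < n/2. Then the digraph D₀(n/3, n−2k−1) has at most (1/3)·(k·n − B(k,n)) arcs. -/
/-- The outdegree of vertex `i` in the digraph `D₀(v,m)` on vertices `1, …, v`:
`outdeg(i) = min(indeg(i) + m, v − i)`, where `indeg(i)` is the number of vertices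
`i' < i` with an arc to `i`, i.e. with `i ≤ i' + outdeg(i')`. -/
def D0outdeg (v m : ℕ) (i : ℕ) : ℕ :=
  min ((Finset.filter
        (fun i' : Fin i => 1 ≤ (i' : ℕ) ∧ i ≤ (i' : ℕ) + D0outdeg v m (i' : ℕ))
        Finset.univ).card + m) (v - i)
  termination_by i
  decreasing_by
    simp_wf
    exact Fin.is_lt _

/-- The number of arcs of the digraph `D₀(v,m)`: there is an arc from `i` to `j`
(for `1 ≤ i < j ≤ v`) if and only if `j ≤ i + outdeg(i)`. -/
def D0arcs (v m : ℕ) : ℕ :=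
  ((Finset.Icc 1 v ×ˢ Finset.Icc 1 v).filter
    (fun p => p.1 < p.2 ∧ p.2 ≤ p.1 + D0outdeg v m p.1)).card
theorem D0outdeg_le_sub (v m i : ℕ) : D0outdeg v m i ≤ v - i := by
  rw [D0outdeg]
  exact min_le_right _ _

/-- The outdegree of `x + 1` is at most `m` or is bounded through the first in-neighbour `a`. -/
theorem D0outdeg_succ_le (v m x : ℕ) : D0outdeg v m (x + 1) ≤ m ∨
    ∃ a, 1 ≤ a ∧ a ≤ x ∧ x + 1 ≤ a + D0outdeg v m a ∧
      D0outdeg v m (x + 1) + a ≤ x + 1 + m := by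
  have h := min_le_left ((Finset.filter
    (fun i' : Fin (x + 1) => 1 ≤ (i' : ℕ) ∧ x + 1 ≤ (i' : ℕ) + D0outdeg v m (i' : ℕ))
    Finset.univ).card + m) (v - (x + 1))
  rw [← D0outdeg] at h
  set S := Finset.filter
    (fun i' : Fin (x + 1) => 1 ≤ (i' : ℕ) ∧ x + 1 ≤ (i' : ℕ) + D0outdeg v m (i' : ℕ))
    Finset.univ
  rcases S.eq_empty_or_nonempty with h0 | hne
  · left
    simpa [h0] using h
  · right
    have hmem := (Finset.mem_filter.1 (S.min'_mem hne)).2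
    have hlt := (S.min' hne).is_lt
    have hcard : S.card ≤ (Finset.Ici (S.min' hne)).card :=
      Finset.card_le_card fun b hb => Finset.mem_Ici.2 (S.min'_le b hb)
    rw [Fin.card_Ici] at hcard
    exact ⟨S.min' hne, hmem.1, by omega, hmem.2, by omega⟩

theorem D0outdeg_linear_bound (v m j x : ℕ) :
    2 * (j + 1) * D0outdeg v m (x + 1) ≤ 2 * x + (j + 1) * (j + 2) * m := by
  induction j generalizing x with
  | zero =>
    rcases D0outdeg_succ_le v m x with h | ⟨a, h1, h2, h3, h4⟩
    · omega
    · omega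
  | succ j ih =>
    rcases D0outdeg_succ_le v m x with h | ⟨a, h1, h2, h3, h4⟩
    · nlinarith [Nat.zero_le (j * m), Nat.zero_le (j * j * m),
        Nat.mul_le_mul_left (2 * (j + 2)) h]
    · obtain ⟨b, rfl⟩ : ∃ b, a = b + 1 := ⟨a - 1, by omega⟩
      have := ih b
      nlinarith [Nat.mul_le_mul_left (2 * (j + 2)) h4, Nat.mul_le_mul_left (2 * (j + 1)) h3]

theorem D0arcs_le_sum (v m : ℕ) :
    D0arcs v m ≤ ∑ x ∈ Finset.range v, D0outdeg v m (x + 1) := by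
  have hI : ∑ x ∈ Finset.range v, D0outdeg v m (x + 1)
      = ∑ i ∈ Finset.Icc 1 v, D0outdeg v m i := by
    rw [Finset.range_eq_Ico, Finset.sum_Ico_add' (fun i => D0outdeg v m i) 0 v 1]
    rfl
  rw [hI, D0arcs, Finset.card_filter, Finset.sum_product]
  refine Finset.sum_le_sum fun i _ => ?_
  rw [← Finset.card_filter]
  calc _ ≤ (Finset.Ioc i (i + D0outdeg v m i)).card :=
        Finset.card_le_card fun y hy => Finset.mem_Ioc.2 (Finset.mem_filter.1 hy).2
    _ = _ := by simp

theorem sum_range_div_le (J q e : ℕ) (he : e ≤ J + 1) :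
    ∑ t ∈ Finset.range (q * (J + 1) + e), ((t / (J + 1) : ℕ) : ℝ)
      ≤ (J + 1) * q * (q - 1) / 2 + e * q := by
  have step : ∀ q e : ℕ, e ≤ J + 1 →
      ∑ t ∈ Finset.range (q * (J + 1) + e), ((t / (J + 1) : ℕ) : ℝ)
        = ∑ t ∈ Finset.range (q * (J + 1)), ((t / (J + 1) : ℕ) : ℝ) + e * q := by
    intro q e he
    rw [Finset.sum_range_add]
    congr 1
    rw [Finset.sum_congr rfl (g := fun _ => (q : ℝ)), Finset.sum_const, Finset.card_range,
      nsmul_eq_mul]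
    intro t ht
    have ht := Finset.mem_range.1 ht
    rw [mul_comm q, Nat.mul_add_div (Nat.succ_pos J), Nat.div_eq_of_lt (by omega), add_zero]
  have full : ∑ t ∈ Finset.range (q * (J + 1)), ((t / (J + 1) : ℕ) : ℝ)
      = (J + 1) * q * (q - 1) / 2 := by
    induction q with
    | zero => simp
    | succ q ih =>
      rw [Nat.succ_mul, step q _ le_rfl, ih]
      push_cast
      ring
  rw [step q e he, full]

/-- Bound on the outdegrees of the first `q (J + 1) + e` vertices of the `(J + 1)`-st block. -/
theorem sum_D0outdeg_block_le (v m J q e B : ℕ) (hB : 2 * B = (J + 1) * J * m)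
    (he : e ≤ J + 1) :
    ∑ x ∈ Finset.range (B + (q * (J + 1) + e)), (D0outdeg v m (x + 1) : ℝ)
      ≤ ∑ x ∈ Finset.range B, (D0outdeg v m (x + 1) : ℝ)
        + ((q * (J + 1) + e) * (J + 1) * m + (J + 1) * q * (q - 1) / 2 + e * q) := by
  rw [Finset.sum_range_add]
  have hterm : ∀ t : ℕ, (D0outdeg v m (B + t + 1) : ℝ)
      ≤ (J + 1) * m + ((t / (J + 1) : ℕ) : ℝ) := by
    intro t
    have h := D0outdeg_linear_bound v m J (B + t)
    have h2 : D0outdeg v m (B + t + 1) ≤ (t + (J + 1) * m * (J + 1)) / (J + 1) := by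
      rw [Nat.le_div_iff_mul_le (Nat.succ_pos J)]
      nlinarith
    rw [Nat.add_mul_div_right _ _ (Nat.succ_pos J)] at h2
    have h3 : (D0outdeg v m (B + t + 1) : ℝ) ≤ ((t / (J + 1) + (J + 1) * m : ℕ) : ℝ) := by
      exact_mod_cast h2
    push_cast at h3 ⊢
    linarith
  have h := Finset.sum_le_sum fun t (_ : t ∈ Finset.range (q * (J + 1) + e)) => hterm t
  rw [Finset.sum_add_distrib, Finset.sum_const, Finset.card_range, nsmul_eq_mul] at h
  have h2 := sum_range_div_le J q e he
  push_cast at h h2 ⊢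
  linarith

theorem sum_D0outdeg_blocks_le (v m J : ℕ) : ∃ B : ℕ, 2 * B = (J + 1) * J * m ∧
    ∑ x ∈ Finset.range B, (D0outdeg v m (x + 1) : ℝ)
      ≤ (m : ℝ) ^ 2 * (J * (J + 1) * (2 * J + 1)) / 6 + m * (m - 1) * (J * (J + 1)) / 4 := by
  induction J with
  | zero => exact ⟨0, by simp⟩
  | succ J ih =>
    obtain ⟨B, hB, hA⟩ := ih
    refine ⟨B + (m * (J + 1) + 0), by nlinarith, ?_⟩
    have h := sum_D0outdeg_block_le v m J m 0 B hB (Nat.zero_le _)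
    push_cast at h ⊢
    linarith

theorem sum_D0outdeg_tail_le (m N L : ℕ) :
    ∑ x ∈ Finset.range L, (D0outdeg (N + L) m (N + x + 1) : ℝ) ≤ L * (L - 1) / 2 := by
  have hs : ∀ (c : ℝ) (M : ℕ), ∑ x ∈ Finset.range M, (c - x) = c * M - M * (M - 1) / 2 := by
    intro c M
    induction M with
    | zero => simp
    | succ M ih =>
      rw [Finset.sum_range_succ, ih]
      push_cast
      ring
  have h : ∑ x ∈ Finset.range L, (D0outdeg (N + L) m (N + x + 1) : ℝ)
      ≤ ∑ x ∈ Finset.range L, ((L : ℝ) - 1 - x) := by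
    refine Finset.sum_le_sum fun x hx => ?_
    have hx := Finset.mem_range.1 hx
    have h1 := D0outdeg_le_sub (N + L) m (N + x + 1)
    have h2 : D0outdeg (N + L) m (N + x + 1) + (1 + x) ≤ L := by omega
    have h3 : ((D0outdeg (N + L) m (N + x + 1) + (1 + x) : ℕ) : ℝ) ≤ L := by exact_mod_cast h2
    push_cast at h3
    linarith
  rw [hs] at h
  linarith

theorem D0arcs_le_of_eq (v m J q e : ℕ) (he : e ≤ J + 1)
    (hv : 2 * v = (J + 2) * (J + 1) * m + 2 * (q * (J + 2) + e)) :
    (D0arcs v m : ℝ) ≤ (v : ℝ) * (v - 1) / 2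
      - ((v : ℝ) ^ 2 / 2 * (1 - 1 / (J + 2)) - v * m * (J + 1) / 2
        + (m : ℝ) ^ 2 * ((J + 1) * (J + 2) * (J + 3)) / 24)
      + e * (J + 2 - e) / (2 * (J + 2)) := by
  obtain ⟨B, hB, hA⟩ := sum_D0outdeg_blocks_le v m J
  have h1 := sum_D0outdeg_block_le v m J q e B hB he
  have hvN : v = B + (q * (J + 1) + e) + ((J + 1) * m + q) := by nlinarith
  have h2 := sum_D0outdeg_tail_le m (B + (q * (J + 1) + e)) ((J + 1) * m + q)
  rw [← hvN] at h2
  have h3 : (D0arcs v m : ℝ) ≤ ∑ x ∈ Finset.range v, (D0outdeg v m (x + 1) : ℝ) := by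
    exact_mod_cast D0arcs_le_sum v m
  have h4 : ∑ x ∈ Finset.range v, (D0outdeg v m (x + 1) : ℝ)
      = ∑ x ∈ Finset.range (B + (q * (J + 1) + e)), (D0outdeg v m (x + 1) : ℝ)
        + ∑ x ∈ Finset.range ((J + 1) * m + q),
          (D0outdeg v m (B + (q * (J + 1) + e) + x + 1) : ℝ) := by
    rw [← Finset.sum_range_add (fun x => (D0outdeg v m (x + 1) : ℝ)), ← hvN]
  have hvR : (v : ℝ) = (J + 2) * (J + 1) * m / 2 + (q * (J + 2) + e) := by
    have : ((2 * v : ℕ) : ℝ) = ((J + 2) * (J + 1) * m + 2 * (q * (J + 2) + e) : ℕ) := by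
      rw [hv]
    push_cast at this
    linarith
  have hJ : (J : ℝ) + 2 ≠ 0 := by positivity
  push_cast at h2
  have key : (m : ℝ) ^ 2 * (J * (J + 1) * (2 * J + 1)) / 6 + m * (m - 1) * (J * (J + 1)) / 4
      + ((q * (J + 1) + e) * (J + 1) * m + (J + 1) * q * (q - 1) / 2 + e * q)
      + ((J + 1) * m + q) * ((J + 1) * m + q - 1) / 2
      = (v : ℝ) * (v - 1) / 2
      - ((v : ℝ) ^ 2 / 2 * (1 - 1 / (J + 2)) - v * m * (J + 1) / 2
        + (m : ℝ) ^ 2 * ((J + 1) * (J + 2) * (J + 3)) / 24)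
      + e * (J + 2 - e) / (2 * (J + 2)) := by
    rw [hvR]
    field_simp
    ring
  linarith

theorem mul_rbinom2_le {p z : ℝ} (hp : 0 < p) :
    p * rbinom2 (z / p + 1 / 2) ≤ z ^ 2 / (2 * p) - min (p / 8) (z ^ 2 / (2 * p)) := by
  unfold rbinom2
  split_ifs
  · have : p * ((z / p + 1 / 2) * (z / p + 1 / 2 - 1) / 2) = z ^ 2 / (2 * p) - p / 8 := by
      field_simp
      ring
    rw [this]
    linarith [min_le_left (p / 8) (z ^ 2 / (2 * p))]
  · linarith [min_le_right (p / 8) (z ^ 2 / (2 * p))]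

theorem sum_sq_div_eq (v m : ℝ) (N : ℕ) :
    ∑ j ∈ Finset.Ico 2 (N + 2), (v - (j : ℝ) * (j + 1) / 2 * m) ^ 2 / (2 * ((j : ℝ) * (j + 1)))
      = v ^ 2 / 2 * (1 - 1 / (N + 2)) - v * m * (N + 1) / 2
        + m ^ 2 * ((N + 1) * (N + 2) * (N + 3)) / 24 - (v - m) ^ 2 / 4 := by
  induction N with
  | zero =>
    simp
    ring
  | succ N ih =>
    rw [show N + 1 + 2 = (N + 2) + 1 by ring, Finset.sum_Ico_succ_top (by omega), ih]
    push_cast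
    have h2 : (N : ℝ) + 2 ≠ 0 := by positivity
    have h3 : (N : ℝ) + 3 ≠ 0 := by positivity
    have h3' : (N : ℝ) + 1 + 2 ≠ 0 := by positivity
    have h3'' : (N : ℝ) + 2 + 1 ≠ 0 := by positivity
    field_simp
    ring

theorem sum_mul_rbinom2_le (v m J q e : ℕ) (hm : 1 ≤ m) (he : e ≤ J + 1)
    (hpos : 1 ≤ q * (J + 2) + e)
    (hv : 2 * v = (J + 2) * (J + 1) * m + 2 * (q * (J + 2) + e)) :
    ∑ j ∈ Finset.Ico 2 (J + 2), (j : ℝ) * (j + 1) *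
        rbinom2 (((v : ℝ) - (j : ℝ) * (j + 1) / 2 * m) / ((j : ℝ) * (j + 1)) + 1 / 2)
      ≤ ∑ j ∈ Finset.Ico 2 (J + 2),
          ((v : ℝ) - (j : ℝ) * (j + 1) / 2 * m) ^ 2 / (2 * ((j : ℝ) * (j + 1)))
        + 1 / 4 - e * (J + 2 - e) / (2 * (J + 2)) := by
  have hmR : (1 : ℝ) ≤ m := by exact_mod_cast hm
  have hposR : (1 : ℝ) ≤ q * (J + 2) + e := by exact_mod_cast hpos
  have hvR : (v : ℝ) = (J + 2) * (J + 1) * m / 2 + (q * (J + 2) + e) := by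
    have : ((2 * v : ℕ) : ℝ) = ((J + 2) * (J + 1) * m + 2 * (q * (J + 2) + e) : ℕ) := by
      rw [hv]
    push_cast at this
    linarith
  have herr : (e : ℝ) * (J + 2 - e) / (2 * (J + 2)) ≤ (J + 2) / 8 := by
    rw [div_le_div_iff₀ (by positivity) (by norm_num)]
    nlinarith [sq_nonneg ((J : ℝ) + 2 - 2 * e)]
  match J, he, hpos, hv, hposR, hvR, herr with
  | 0, _, _, _, _, _, herr =>
    norm_num at herr ⊢
    linarith
  | 1, he, _, _, hposR, hvR, _ =>
    have hz : (1 : ℝ) ≤ v - 3 * m := by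
      rw [hvR]
      push_cast at hposR ⊢
      linarith
    have hmin : (1 : ℝ) / 12 ≤ min (6 / 8) (((v : ℝ) - 3 * m) ^ 2 / (2 * 6)) := by
      apply le_min
      · norm_num
      · nlinarith
    have h := (mul_rbinom2_le (p := 6) (z := (v : ℝ) - 3 * m) (by norm_num)).trans
      (sub_le_sub_left hmin _)
    have he3 : (e : ℝ) * (1 + 2 - e) / (2 * (1 + 2)) ≤ 1 / 3 := by
      interval_cases e <;> norm_num
    rw [show Finset.Ico 2 (1 + 2) = {2} from rfl, Finset.sum_singleton, Finset.sum_singleton]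
    norm_num at h he3 ⊢
    linarith
  | K + 2, _, _, _, hposR, hvR, herr =>
    rw [show K + 2 + 2 = (K + 3) + 1 by ring,
      Finset.sum_Ico_succ_top (b := K + 3) (by omega),
      Finset.sum_Ico_succ_top (b := K + 3) (by omega)]
    have hlast : ((K + 3 : ℕ) : ℝ) * ((K + 3 : ℕ) + 1) *
        rbinom2 (((v : ℝ) - ((K + 3 : ℕ) : ℝ) * ((K + 3 : ℕ) + 1) / 2 * m) /
          (((K + 3 : ℕ) : ℝ) * ((K + 3 : ℕ) + 1)) + 1 / 2) ≤
        ((v : ℝ) - ((K + 3 : ℕ) : ℝ) * ((K + 3 : ℕ) + 1) / 2 * m) ^ 2 /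
          (2 * (((K + 3 : ℕ) : ℝ) * ((K + 3 : ℕ) + 1))) := by
      refine (mul_rbinom2_le (by positivity)).trans (sub_le_self _ (le_min ?_ ?_)) <;> positivity
    have hrest : ∑ j ∈ Finset.Ico 2 (K + 3), (j : ℝ) * (j + 1) *
        rbinom2 (((v : ℝ) - (j : ℝ) * (j + 1) / 2 * m) / ((j : ℝ) * (j + 1)) + 1 / 2)
        ≤ ∑ j ∈ Finset.Ico 2 (K + 3),
          (((v : ℝ) - (j : ℝ) * (j + 1) / 2 * m) ^ 2 / (2 * ((j : ℝ) * (j + 1))) - 1 / 2) := by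
      refine Finset.sum_le_sum fun j hj => ?_
      obtain ⟨hj2, hjK⟩ := Finset.mem_Ico.1 hj
      have hj2R : (2 : ℝ) ≤ j := by exact_mod_cast hj2
      have hjKR : (j : ℝ) ≤ K + 2 := by exact_mod_cast (by omega : j ≤ K + 2)
      have hp : (0 : ℝ) < (j : ℝ) * (j + 1) := by positivity
      refine (mul_rbinom2_le hp).trans (sub_le_sub_left (le_min ?_ ?_) _)
      · nlinarith
      · have hz : (j : ℝ) + 1 ≤ v - (j : ℝ) * (j + 1) / 2 * m := by
          have hc : ((j : ℝ) + 1) * (j + 2) / 2 * m ≤ ((K : ℝ) + 4) * (K + 3) / 2 * m := by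
            have : ((j : ℝ) + 1) * (j + 2) ≤ ((K : ℝ) + 4) * (K + 3) := by nlinarith
            gcongr
          push_cast at hvR hposR
          nlinarith
        rw [div_le_div_iff₀ (by norm_num) (by positivity)]
        nlinarith
    rw [Finset.sum_sub_distrib, Finset.sum_const, Nat.card_Ico, nsmul_eq_mul,
      show K + 3 - 2 = K + 1 by omega] at hrest
    push_cast at hrest hlast herr ⊢
    have hK : (0 : ℝ) ≤ K := Nat.cast_nonneg K
    linarith

theorem rbinom2_nonneg (r : ℝ) : 0 ≤ rbinom2 r := by
  unfold rbinom2
  split_ifs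
  · nlinarith
  · exact le_rfl

theorem rbinom2_natCast {s : ℕ} (hs : 0 < s) : rbinom2 (s : ℝ) = s * (s - 1) / 2 := by
  unfold rbinom2
  split_ifs with h
  · rfl
  · have h1 : s < 2 := by exact_mod_cast not_le.1 h
    obtain rfl : s = 1 := by omega
    norm_num

/-- For `3 ∣ n` and `n/3 < k < n/2`, the digraph `D₀(n/3, n − 2k − 1)` has at most
`(k·n − B(k,n))/3` arcs. -/
theorem D0arcs_le (n k s : ℕ) (hn : 0 < n) (h3 : 3 ∣ n)
    (hk1 : n / 3 < k) (hk2 : 2 * k < n)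
    (hs : 0 < s ∧ rbinom2 (s : ℝ) < (n : ℝ) / (3 * ((n : ℝ) - 2 * k - 1)) ∧
      (n : ℝ) / (3 * ((n : ℝ) - 2 * k - 1)) ≤ rbinom2 ((s : ℝ) + 1)) :
    (D0arcs (n / 3) (n - 2 * k - 1) : ℝ) ≤ ((k : ℝ) * (n : ℝ) - Bkn k n s) / 3 := by
  obtain ⟨v, rfl⟩ := h3
  obtain ⟨hs0, hlo, hhi⟩ := hs
  rw [Nat.mul_div_cancel_left v (by norm_num)] at hk1 ⊢
  obtain ⟨m, hm⟩ : ∃ m, m = 3 * v - 2 * k - 1 := ⟨_, rfl⟩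
  rw [← hm]
  have hmR : ((3 * v : ℕ) : ℝ) - 2 * k - 1 = m := by
    have h : 3 * v = m + 2 * k + 1 := by omega
    rw [h]
    push_cast
    ring
  have hkR : (k : ℝ) = (3 * v - m - 1) / 2 := by
    push_cast at hmR
    linarith
  rw [hmR] at hlo hhi
  have hm1 : 1 ≤ m := by
    by_contra h
    obtain rfl : m = 0 := by omega
    have := rbinom2_nonneg (s : ℝ)
    norm_num at hlo
    linarith
  have hm0 : (0 : ℝ) < m := by exact_mod_cast hm1
  have hquot : ((3 * v : ℕ) : ℝ) / (3 * m) = v / m := by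
    push_cast
    rw [mul_div_mul_left _ _ (by norm_num)]
  rw [hquot, rbinom2_natCast hs0, lt_div_iff₀ hm0] at hlo
  have hhi' := rbinom2_natCast (Nat.succ_pos s)
  push_cast at hhi'
  rw [hquot, hhi', div_le_iff₀ hm0] at hhi
  have hs2 : 2 ≤ s := by
    by_contra h
    obtain rfl : s = 1 := by omega
    norm_num at hhi
    omega
  obtain ⟨J, rfl⟩ : ∃ J, s = J + 2 := ⟨s - 2, by omega⟩
  push_cast at hlo
  have hloN : (J + 2) * (J + 1) * m < 2 * v := by
    have : (((J + 2) * (J + 1) * m : ℕ) : ℝ) < (2 * v : ℕ) := by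
      push_cast
      linarith
    exact_mod_cast this
  obtain ⟨c, hc⟩ : Even ((J + 2) * (J + 1) * m) :=
    (mul_comm (J + 1) (J + 2) ▸ Nat.even_mul_succ_self (J + 1)).mul_right m
  have hdm := Nat.div_add_mod (v - c) (J + 2)
  have hel := Nat.mod_lt (v - c) (Nat.succ_pos (J + 1))
  generalize (v - c) / (J + 2) = q at hdm
  generalize he : (v - c) % (J + 2) = e at hdm
  rw [mul_comm] at hdm
  have heJ : e ≤ J + 1 := by
    rw [← he]
    exact Nat.lt_succ_iff.1 hel
  have hpos : 1 ≤ q * (J + 2) + e := by omega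
  have hv : 2 * v = (J + 2) * (J + 1) * m + 2 * (q * (J + 2) + e) := by omega
  have harcs := D0arcs_le_of_eq v m J q e heJ hv
  have hsum := sum_mul_rbinom2_le v m J q e hm1 heJ hpos hv
  rw [sum_sq_div_eq] at hsum
  have hterms : ∑ j ∈ Finset.Icc 2 (J + 2 - 1), (j : ℝ) * ((j : ℝ) + 1) *
      rbinom2 ((k : ℝ) + 1 - cseq j * ((3 * v : ℕ) : ℝ))
      = ∑ j ∈ Finset.Ico 2 (J + 2), (j : ℝ) * (j + 1) *
        rbinom2 (((v : ℝ) - (j : ℝ) * (j + 1) / 2 * m) / ((j : ℝ) * (j + 1)) + 1 / 2) := by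
    refine Finset.sum_congr (by ext j; simp; omega) fun j hj => ?_
    have hj2 := (Finset.mem_Ico.1 hj).1
    have hjR : (0 : ℝ) < j := by exact_mod_cast (by omega : 0 < j)
    congr 2
    rw [hkR, cseq]
    push_cast
    field_simp
    ring
  have hb1 : rbinom2 ((k : ℝ) + 1) = (k + 1) * k / 2 := by
    have := rbinom2_natCast (Nat.succ_pos k)
    push_cast at this
    rw [this]
    ring
  have hb2 : rbinom2 ((k : ℝ) + 1 - ((3 * v : ℕ) : ℝ) / 3) = (k + 1 - v) * (k - v) / 2 := by
    have h1 : (v : ℝ) + 1 ≤ k := by exact_mod_cast hk1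
    unfold rbinom2
    push_cast
    rw [if_pos (by linarith)]
    ring
  rw [Bkn, hterms, hb1, hb2]
  push_cast
  have hpoly : (k : ℝ) * v - (k + 1) * k / 2 - (k + 1 - v) * (k - v) / 2
      = (v : ℝ) * (v - 1) / 2 - (v - m) ^ 2 / 4 + 1 / 4 := by
    rw [hkR]
    ring
  linarith
end

section
/- There exists a 3-symmetric set P of 30 points in general position in the plane with cr(P) = 9726. In particular, the rectilinear crossing number satisfies cr(K_30) ≤ 9726. -/
/-- A finite planar point set is in general position if no three of its points are collinear. -/
def GenPos (P : Finset (ℝ × ℝ)) : Prop :=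
  ∀ p ∈ P, ∀ q ∈ P, ∀ r ∈ P, p ≠ q → p ≠ r → q ≠ r →
    ¬ Collinear ℝ ({p, q, r} : Set (ℝ × ℝ))

/-- A set of points is in convex position if no point lies in the convex hull of the others. -/
def ConvexPos (S : Set (ℝ × ℝ)) : Prop :=
  ∀ p ∈ S, p ∉ convexHull ℝ (S \ {p})

/-- `crNum P` is the number of 4-element subsets of `P` in convex position. -/
noncomputable def crNum (P : Finset (ℝ × ℝ)) : ℕ :=
  Set.ncard {Q : Finset (ℝ × ℝ) | Q ⊆ P ∧ Q.card = 4 ∧ ConvexPos (↑Q : Set (ℝ × ℝ))}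

/-- The rectilinear crossing number of `K_n`: the minimum of `crNum P` over all sets `P` of `n`
points in general position in the plane. -/
noncomputable def rcn (n : ℕ) : ℕ :=
  sInf {c : ℕ | ∃ P : Finset (ℝ × ℝ), P.card = n ∧ GenPos P ∧ crNum P = c}

/-- Rotation by angle `2π/3` about the point `o`. -/
noncomputable def rot120 (o p : ℝ × ℝ) : ℝ × ℝ :=
  (o.1 + Real.cos (2 * Real.pi / 3) * (p.1 - o.1) - Real.sin (2 * Real.pi / 3) * (p.2 - o.2),
   o.2 + Real.sin (2 * Real.pi / 3) * (p.1 - o.1) + Real.cos (2 * Real.pi / 3) * (p.2 - o.2))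

/-- A planar point set is 3-symmetric if some rotation by `2π/3` about a point not in the set
maps the set onto itself. -/
def ThreeSym (P : Finset (ℝ × ℝ)) : Prop :=
  ∃ o : ℝ × ℝ, o ∉ P ∧ rot120 o '' (P : Set (ℝ × ℝ)) = (P : Set (ℝ × ℝ))

/-- Twice the signed area of the triangle `p q r`. -/
def signedArea (p q r : ℝ × ℝ) : ℝ :=
  (q.1 - p.1) * (r.2 - p.2) - (q.2 - p.2) * (r.1 - p.1)

theorem signedArea_eq_zero_of_collinear {p q r : ℝ × ℝ}
    (h : Collinear ℝ ({p, q, r} : Set (ℝ × ℝ))) : signedArea p q r = 0 := by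
  obtain ⟨v, hv⟩ := (collinear_iff_of_mem (p₀ := p) (by simp)).1 h
  obtain ⟨t, rfl⟩ := hv q (by simp)
  obtain ⟨u, rfl⟩ := hv r (by simp)
  simp only [signedArea, vadd_eq_add, Prod.fst_add, Prod.snd_add, Prod.smul_fst, Prod.smul_snd,
    smul_eq_mul]
  ring

theorem mem_convexHull_triple_iff {p q r s : ℝ × ℝ} (h : signedArea q r s ≠ 0) :
    p ∈ convexHull ℝ ({q, r, s} : Set (ℝ × ℝ)) ↔
      0 ≤ signedArea p r s / signedArea q r s ∧ 0 ≤ signedArea q p s / signedArea q r s ∧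
        0 ≤ signedArea q r p / signedArea q r s := by
  constructor
  · rw [convexHull_insert (by simp), convexHull_pair, convexJoin_singleton_left]
    simp only [Set.mem_iUnion, segment, Set.mem_ofPred_eq]
    rintro ⟨_, ⟨c, d, hc, hd, hcd, rfl⟩, a, b, ha, hb, hab, rfl⟩
    obtain rfl : c = 1 - d := by linarith
    obtain rfl : a = 1 - b := by linarith
    refine ⟨?_, ?_, ?_⟩
    · refine ha.trans_eq ((eq_div_iff h).2 ?_)
      simp only [signedArea, Prod.fst_add, Prod.snd_add, Prod.smul_fst, Prod.smul_snd, smul_eq_mul]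
      ring
    · refine (mul_nonneg hb hc).trans_eq ((eq_div_iff h).2 ?_)
      simp only [signedArea, Prod.fst_add, Prod.snd_add, Prod.smul_fst, Prod.smul_snd, smul_eq_mul]
      ring
    · refine (mul_nonneg hb hd).trans_eq ((eq_div_iff h).2 ?_)
      simp only [signedArea, Prod.fst_add, Prod.snd_add, Prod.smul_fst, Prod.smul_snd, smul_eq_mul]
      ring
  · rintro ⟨hq, hr, hs⟩
    have key := (convex_convexHull ℝ ({q, r, s} : Set (ℝ × ℝ))).sum_mem (t := Finset.univ)
      (w := ![signedArea p r s / signedArea q r s, signedArea q p s / signedArea q r s,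
        signedArea q r p / signedArea q r s]) (z := ![q, r, s])
      (by simpa [Fin.forall_fin_succ] using ⟨hq, hr, hs⟩)
      (by
        simp only [Fin.sum_univ_three, Matrix.cons_val]
        field_simp
        simp only [signedArea]
        ring)
      (by
        simp only [Finset.mem_univ, true_imp_iff, Fin.forall_fin_succ]
        exact ⟨subset_convexHull ℝ _ (by simp), subset_convexHull ℝ _ (by simp),
          subset_convexHull ℝ _ (by simp), fun i => i.elim0⟩)
    convert key using 1
    simp only [Fin.sum_univ_three, Matrix.cons_val]
    ext <;> simp only [Prod.fst_add, Prod.snd_add, Prod.smul_fst, Prod.smul_snd, smul_eq_mul] <;>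
      field_simp <;> simp only [signedArea] <;> ring

theorem signedArea_rotate (p q r : ℝ × ℝ) : signedArea q r p = signedArea p q r := by
  simp only [signedArea]; ring

theorem signedArea_swap (p q r : ℝ × ℝ) : signedArea q p r = -signedArea p q r := by
  simp only [signedArea]; ring

theorem signedArea_swap_right (p q r : ℝ × ℝ) : signedArea p r q = -signedArea p q r := by
  simp only [signedArea]; ring

theorem ne_of_signedArea_ne_zero {p q r : ℝ × ℝ} (h : signedArea p q r ≠ 0) :
    p ≠ q ∧ p ≠ r ∧ q ≠ r := by
  refine ⟨?_, ?_, ?_⟩ <;> rintro rfl <;> apply h <;> simp only [signedArea] <;> ring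

/-- Four points, no three of which are collinear, are in convex position exactly when two of the
four coefficients of their affine dependence are positive and two are negative. -/
theorem convexPos_iff {a b c d : ℝ × ℝ} (habc : signedArea a b c ≠ 0) (habd : signedArea a b d ≠ 0)
    (hacd : signedArea a c d ≠ 0) (hbcd : signedArea b c d ≠ 0) :
    ConvexPos {a, b, c, d} ↔
      ((0 < signedArea a b c ↔ 0 < signedArea a b d) ↔
        (0 < signedArea a c d ↔ 0 < signedArea b c d)) := by
  obtain ⟨hab, hac, hbc⟩ := ne_of_signedArea_ne_zero habc
  obtain ⟨-, had, hbd⟩ := ne_of_signedArea_ne_zero habd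
  obtain ⟨-, -, hcd⟩ := ne_of_signedArea_ne_zero hacd
  have ha : ({a, b, c, d} : Set (ℝ × ℝ)) \ {a} = {b, c, d} := by ext x; simp; grind
  have hb : ({a, b, c, d} : Set (ℝ × ℝ)) \ {b} = {a, c, d} := by ext x; simp; grind
  have hc : ({a, b, c, d} : Set (ℝ × ℝ)) \ {c} = {a, b, d} := by ext x; simp; grind
  have hd : ({a, b, c, d} : Set (ℝ × ℝ)) \ {d} = {a, b, c} := by ext x; simp; grind
  simp only [ConvexPos, Set.mem_insert_iff, Set.mem_singleton_iff, forall_eq_or_imp, forall_eq,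
    ha, hb, hc, hd, mem_convexHull_triple_iff, habc, habd, hacd, hbcd, ne_eq, not_false_eq_true]
  rw [signedArea_swap a b d, signedArea_rotate a b c, signedArea_swap_right a b c,
    signedArea_swap b c d, ← signedArea_rotate d b c, signedArea_swap_right a c d]
  generalize signedArea a b c = w at *
  generalize signedArea a b d = x at *
  generalize signedArea a c d = y at *
  generalize signedArea b c d = z at *
  rcases lt_or_gt_of_ne habc with hw | hw <;> rcases lt_or_gt_of_ne habd with hx | hx <;>
    rcases lt_or_gt_of_ne hacd with hy | hy <;> rcases lt_or_gt_of_ne hbcd with hz | hz <;>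
    simp [div_nonneg_iff, hw, hx, hy, hz, hw.le, hx.le, hy.le, hz.le, hw.not_ge, hx.not_ge,
      hy.not_ge, hz.not_ge, hw.not_gt, hx.not_gt, hy.not_gt, hz.not_gt]

/-- `countSublists k p l` is the number of sublists of `l` of length `k` that satisfy `p`. -/
def countSublists {α : Type*} : ℕ → (List α → Bool) → List α → ℕ
  | 0, p, _ => if p [] then 1 else 0
  | _ + 1, _, [] => 0
  | k + 1, p, a :: l => countSublists (k + 1) p l + countSublists k (fun s => p (a :: s)) l

theorem card_filter_powersetCard_toFinset {α : Type*} [DecidableEq α] (k : ℕ) {l : List α}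
    (hl : l.Nodup) (p : List α → Bool) (P : Finset α → Prop) [DecidablePred P]
    (h : ∀ s, s.Sublist l → s.length = k → (P s.toFinset ↔ p s)) :
    ((Finset.powersetCard k l.toFinset).filter P).card = countSublists k p l := by
  induction l generalizing k p P with
  | nil =>
    cases k with
    | zero =>
      have := h [] (List.Sublist.refl _) rfl
      simp_all [countSublists, Finset.filter_singleton, apply_ite Finset.card]
    | succ k => simp [countSublists]
  | cons a l ih =>
    rw [List.nodup_cons] at hl
    have ha : a ∉ l.toFinset := by simpa using hl.1
    cases k with
    | zero =>
      have := h [] (List.nil_sublist _) rfl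
      simp_all [countSublists, Finset.filter_singleton, apply_ite Finset.card]
    | succ k =>
      have hinj : Set.InjOn (insert a)
          ((Finset.powersetCard k l.toFinset).filter fun s => P (insert a s) :
            Set (Finset α)) := by
        intro s hs t ht hst
        simp only [Finset.coe_filter, Finset.mem_powersetCard, Set.mem_ofPred_eq] at hs ht
        rw [← Finset.erase_insert (fun h => ha (hs.1.1 h)), hst,
          Finset.erase_insert (fun h => ha (ht.1.1 h))]
      rw [countSublists, List.toFinset_cons, Finset.powersetCard_succ_insert ha,
        Finset.filter_union, Finset.filter_image, Finset.card_union_of_disjoint,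
        Finset.card_image_of_injOn hinj,
        ih (k + 1) hl.2 p P fun s hs => h s (hs.cons a),
        ih k hl.2 (fun s => p (a :: s)) (fun s => P (insert a s))]
      · intro s hs hk
        simpa using h (a :: s) (hs.cons_cons a) (by simpa using hk)
      · rw [Finset.disjoint_left]
        intro s hs hs'
        simp only [Finset.mem_filter, Finset.mem_powersetCard, Finset.mem_image] at hs hs'
        obtain ⟨t, -, rfl⟩ := hs'
        exact ha (hs.1.1 (Finset.mem_insert_self a t))

/-- The affine embedding of the integer grid as a triangular lattice. -/
noncomputable def lattice (p : ℕ × ℕ) : ℝ × ℝ :=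
  (p.1 - p.2 / 2, √3 / 2 * p.2)

theorem lattice_injective : Function.Injective lattice := by
  rintro ⟨a, b⟩ ⟨c, d⟩ h
  simp only [lattice, Prod.mk.injEq] at h
  have hbd : (b : ℝ) = d := mul_left_cancel₀ (by positivity) h.2
  have hac : (a : ℝ) = c := by linarith [h.1]
  exact Prod.ext (by exact_mod_cast hac) (by exact_mod_cast hbd)

/-- The positive part of the determinant computing the signed area of the triangle `p q r`. -/
def areaPos (p q r : ℕ × ℕ) : ℕ := p.1 * q.2 + q.1 * r.2 + r.1 * p.2

/-- The negative part of the determinant computing the signed area of the triangle `p q r`. -/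
def areaNeg (p q r : ℕ × ℕ) : ℕ := p.2 * q.1 + q.2 * r.1 + r.2 * p.1

theorem signedArea_lattice (p q r : ℕ × ℕ) :
    signedArea (lattice p) (lattice q) (lattice r) =
      √3 / 2 * ((areaPos p q r : ℝ) - areaNeg p q r) := by
  simp only [signedArea, lattice, areaPos, areaNeg]
  push_cast
  ring

theorem signedArea_lattice_pos_iff (p q r : ℕ × ℕ) :
    0 < signedArea (lattice p) (lattice q) (lattice r) ↔ areaNeg p q r < areaPos p q r := by
  rw [signedArea_lattice, mul_pos_iff_of_pos_left (by positivity), sub_pos, Nat.cast_lt]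

theorem signedArea_lattice_ne_zero_iff (p q r : ℕ × ℕ) :
    signedArea (lattice p) (lattice q) (lattice r) ≠ 0 ↔ areaPos p q r ≠ areaNeg p q r := by
  rw [signedArea_lattice, mul_ne_zero_iff_left (by positivity), sub_ne_zero, ne_eq, Nat.cast_inj]

/-- Whether the triangle `p q r` is positively oriented. -/
def leftTurn (p q r : ℕ × ℕ) : Bool := Nat.blt (areaNeg p q r) (areaPos p q r)

/-- Decides whether four grid points, no three of them collinear, are in convex position. -/
def convexQuad : List (ℕ × ℕ) → Bool
  | [a, b, c, d] => (leftTurn a b c == leftTurn a b d) == (leftTurn a c d == leftTurn b c d)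
  | _ => false

/-- Grid coordinates of thirty points, invariant under the rotation of order three about
`(300, 300)` in the triangular lattice. -/
def gridPoints : List (ℕ × ℕ) :=
  [(318, 330), (334, 442), (255, 244), (489, 250), (291, 349), (346, 522), (481, 253), (444, 269),
    (492, 249), (138, 170), (270, 288), (158, 192), (356, 311), (350, 539), (251, 242), (78, 124),
    (347, 528), (331, 475), (351, 543), (430, 268), (312, 282), (408, 266), (289, 345), (61, 111),
    (358, 309), (476, 254), (72, 119), (125, 156), (57, 108), (332, 462)]

theorem gridPoints_nodup : gridPoints.Nodup := by decide +kernel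

theorem gridPoints_area_ne : ∀ p ∈ gridPoints, ∀ q ∈ gridPoints, ∀ r ∈ gridPoints,
    p ≠ q → p ≠ r → q ≠ r → areaPos p q r ≠ areaNeg p q r := by
  decide +kernel

theorem countSublists_gridPoints : countSublists 4 convexQuad gridPoints = 9726 := by
  decide +kernel

theorem gridPoints_signedArea_ne_zero {p q r : ℕ × ℕ} (hp : p ∈ gridPoints) (hq : q ∈ gridPoints)
    (hr : r ∈ gridPoints) (hpq : p ≠ q) (hpr : p ≠ r) (hqr : q ≠ r) :
    signedArea (lattice p) (lattice q) (lattice r) ≠ 0 :=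
  (signedArea_lattice_ne_zero_iff p q r).2 (gridPoints_area_ne p hp q hq r hr hpq hpr hqr)

theorem convexPos_lattice_iff {s : List (ℕ × ℕ)} (hs : s.Sublist gridPoints) (hk : s.length = 4) :
    ConvexPos (lattice '' (s.toFinset : Set (ℕ × ℕ))) ↔ convexQuad s := by
  obtain ⟨a, b, c, d, rfl⟩ := List.length_eq_four.1 hk
  have hnd := hs.nodup gridPoints_nodup
  have hmem := hs.subset
  simp only [List.nodup_cons, List.mem_cons, List.not_mem_nil, or_false, not_or,
    List.cons_subset] at hnd hmem
  obtain ⟨⟨hab, hac, had⟩, ⟨hbc, hbd⟩, hcd, -⟩ := hnd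
  obtain ⟨ha, hb, hc, hd, -⟩ := hmem
  simp only [List.toFinset_cons, List.toFinset_nil, Finset.coe_insert, insert_empty_eq,
    Finset.coe_singleton, Set.image_insert_eq, Set.image_singleton]
  rw [convexPos_iff (gridPoints_signedArea_ne_zero ha hb hc hab hac hbc)
    (gridPoints_signedArea_ne_zero ha hb hd hab had hbd)
    (gridPoints_signedArea_ne_zero ha hc hd hac had hcd)
    (gridPoints_signedArea_ne_zero hb hc hd hbc hbd hcd)]
  have hleft (p q r : ℕ × ℕ) : areaNeg p q r < areaPos p q r ↔ leftTurn p q r = true :=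
    Iff.of_eq Nat.blt_eq.symm
  simp only [signedArea_lattice_pos_iff, hleft, convexQuad, beq_iff_eq]
  cases leftTurn a b c <;> cases leftTurn a b d <;> cases leftTurn a c d <;>
    cases leftTurn b c d <;> decide

/-- The points of the triangular lattice given by `gridPoints`. -/
noncomputable def latticePoints : Finset (ℝ × ℝ) :=
  gridPoints.toFinset.map ⟨lattice, lattice_injective⟩

theorem mem_latticePoints {x : ℝ × ℝ} :
    x ∈ latticePoints ↔ ∃ p ∈ gridPoints, lattice p = x := by
  simp [latticePoints]

theorem card_latticePoints : latticePoints.card = 30 := by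
  rw [latticePoints, Finset.card_map, List.toFinset_card_of_nodup gridPoints_nodup]
  rfl

theorem genPos_latticePoints : GenPos latticePoints := by
  intro x hx y hy z hz hxy hxz hyz hcol
  obtain ⟨p, hp, rfl⟩ := mem_latticePoints.1 hx
  obtain ⟨q, hq, rfl⟩ := mem_latticePoints.1 hy
  obtain ⟨r, hr, rfl⟩ := mem_latticePoints.1 hz
  exact gridPoints_signedArea_ne_zero hp hq hr (ne_of_apply_ne _ hxy) (ne_of_apply_ne _ hxz)
    (ne_of_apply_ne _ hyz) (signedArea_eq_zero_of_collinear hcol)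

theorem rot120_lattice {c p q : ℕ × ℕ} (h₁ : q.1 + p.2 = c.1 + c.2)
    (h₂ : q.2 + p.2 + c.1 = p.1 + 2 * c.2) : rot120 (lattice c) (lattice p) = lattice q := by
  have hcos : Real.cos (2 * Real.pi / 3) = -1 / 2 := by
    rw [show 2 * Real.pi / 3 = Real.pi - Real.pi / 3 by ring, Real.cos_pi_sub,
      Real.cos_pi_div_three]
    ring
  have hsin : Real.sin (2 * Real.pi / 3) = √3 / 2 := by
    rw [show 2 * Real.pi / 3 = Real.pi - Real.pi / 3 by ring, Real.sin_pi_sub,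
      Real.sin_pi_div_three]
  have h3 : √3 * √3 = 3 := Real.mul_self_sqrt (by norm_num)
  have e₁ : (q.1 : ℝ) = c.1 + c.2 - p.2 := by
    rw [eq_sub_iff_add_eq]; exact_mod_cast h₁
  have e₂ : (q.2 : ℝ) = p.1 + 2 * c.2 - c.1 - p.2 := by
    rw [eq_sub_iff_add_eq, eq_sub_iff_add_eq]; exact_mod_cast h₂
  simp only [rot120, lattice, hcos, hsin, e₁, e₂, Prod.mk.injEq]
  constructor
  · linear_combination (-((p.2 : ℝ) - c.2) / 4) * h3
  · ring

theorem threeSym_latticePoints : ThreeSym latticePoints := by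
  refine ⟨lattice (300, 300), ?_, ?_⟩
  · rw [mem_latticePoints]
    rintro ⟨p, hp, h⟩
    rw [lattice_injective h] at hp
    revert hp
    decide +kernel
  · have hmaps : ∀ p ∈ gridPoints, ∃ q ∈ gridPoints, q.1 + p.2 = 300 + 300 ∧
        q.2 + p.2 + 300 = p.1 + 2 * 300 := by decide +kernel
    have hsurj : ∀ q ∈ gridPoints, ∃ p ∈ gridPoints, q.1 + p.2 = 300 + 300 ∧
        q.2 + p.2 + 300 = p.1 + 2 * 300 := by decide +kernel
    ext x
    simp only [Set.mem_image, Finset.mem_coe, mem_latticePoints]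
    constructor
    · rintro ⟨_, ⟨p, hp, rfl⟩, rfl⟩
      obtain ⟨q, hq, h₁, h₂⟩ := hmaps p hp
      exact ⟨q, hq, (rot120_lattice h₁ h₂).symm⟩
    · rintro ⟨q, hq, rfl⟩
      obtain ⟨p, hp, h₁, h₂⟩ := hsurj q hq
      exact ⟨_, ⟨p, hp, rfl⟩, rot120_lattice h₁ h₂⟩

open Classical in
theorem crNum_latticePoints : crNum latticePoints = 9726 := by
  have hset : {Q : Finset (ℝ × ℝ) | Q ⊆ latticePoints ∧ Q.card = 4 ∧
      ConvexPos (Q : Set (ℝ × ℝ))} =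
      (Finset.map (Finset.mapEmbedding ⟨lattice, lattice_injective⟩).toEmbedding
        ((Finset.powersetCard 4 gridPoints.toFinset).filter
          fun s => ConvexPos (lattice '' (s : Set (ℕ × ℕ)))) : Set (Finset (ℝ × ℝ))) := by
    ext Q
    rw [Set.mem_ofPred_eq, ← and_assoc, ← Finset.mem_powersetCard, latticePoints,
      Finset.powersetCard_map]
    simp only [Finset.mem_map, Finset.coe_map, Set.mem_image, Finset.mem_coe, Finset.mem_filter]
    constructor
    · rintro ⟨⟨s, hs, rfl⟩, hQ⟩
      exact ⟨s, ⟨hs, by simpa using hQ⟩, rfl⟩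
    · rintro ⟨s, ⟨hs, hQ⟩, rfl⟩
      exact ⟨⟨s, hs, rfl⟩, by simpa using hQ⟩
  rw [crNum, hset, Set.ncard_coe_finset, Finset.card_map, ← countSublists_gridPoints]
  convert card_filter_powersetCard_toFinset 4 gridPoints_nodup convexQuad
    (fun s => ConvexPos (lattice '' (s : Set (ℕ × ℕ))))
    fun s hs hk => convexPos_lattice_iff hs hk

/-- There is a 3-symmetric set of 30 points in general position with exactly 9726 convex
quadrilaterals; in particular the rectilinear crossing number of `K_30` is at most 9726. -/
theorem exists_good_drawing_K30 :
    ∃ P : Finset (ℝ × ℝ), P.card = 30 ∧ GenPos P ∧ ThreeSym P ∧ crNum P = 9726 ∧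
      rcn 30 ≤ 9726 := by
  exact ⟨latticePoints, card_latticePoints, genPos_latticePoints, threeSym_latticePoints,
    crNum_latticePoints,
    Nat.sInf_le ⟨latticePoints, card_latticePoints, genPos_latticePoints, crNum_latticePoints⟩⟩
end

section
/- There exists a 3-symmetric set P of 48 points in general position in the plane with cr(P) = 71022. In particular, the rectilinear crossing number satisfies cr(K_48) ≤ 71022 (improving the previously best known bound of 71025). -/
open Finset

/-! ### Counting sublists satisfying a predicate -/

/-- The number of sublists of length `n` of a list satisfying `q`. -/
def countSub {α : Type*} : ℕ → List α → (List α → Bool) → ℕ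
  | 0, _, q => cond (q []) 1 0
  | _ + 1, [], _ => 0
  | n + 1, a :: l, q => countSub n l (fun u => q (a :: u)) + countSub (n + 1) l q

theorem card_filter_powersetCard_insert {α : Type*} [DecidableEq α] (n : ℕ) {a : α}
    {s : Finset α} (ha : a ∉ s) (p : Finset α → Prop) [DecidablePred p] :
    #{t ∈ powersetCard (n + 1) (insert a s) | p t} =
      #{t ∈ powersetCard n s | p (insert a t)} + #{t ∈ powersetCard (n + 1) s | p t} := by
  rw [powersetCard_succ_insert ha, filter_union, card_union_of_disjoint, filter_image,
    card_image_of_injOn, add_comm]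
  · intro t ht u hu h
    have ht' : a ∉ t := fun h => ha ((mem_powersetCard.1 (mem_filter.1 ht).1).1 h)
    have hu' : a ∉ u := fun h => ha ((mem_powersetCard.1 (mem_filter.1 hu).1).1 h)
    rw [← erase_insert ht', ← erase_insert hu']
    exact congrArg (fun v => Finset.erase v a) h
  · refine disjoint_left.2 fun t ht hu => ?_
    obtain ⟨u, -, rfl⟩ := mem_image.1 (mem_filter.1 hu).1
    exact ha ((mem_powersetCard.1 (mem_filter.1 ht).1).1 (mem_insert_self a u))

theorem card_filter_powersetCard_toFinset_s16 {α : Type*} [DecidableEq α] (n : ℕ) (l : List α)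
    (hl : l.Nodup) (p : Finset α → Prop) [DecidablePred p] (q : List α → Bool)
    (h : ∀ u : List α, u.Sublist l → u.length = n → (p u.toFinset ↔ q u = true)) :
    #{t ∈ powersetCard n l.toFinset | p t} = countSub n l q := by
  induction l generalizing n p q with
  | nil =>
    cases n with
    | zero =>
      have h0 := h [] (List.Sublist.refl _) rfl
      cases hq : q [] <;> simp_all [countSub, filter_singleton]
    | succ n => simp [countSub]
  | cons a l ih =>
    cases n with
    | zero =>
      have h0 := h [] (List.nil_sublist _) rfl
      cases hq : q [] <;> simp_all [countSub, filter_singleton]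
    | succ n =>
      have ha : a ∉ l.toFinset := by simpa using (List.nodup_cons.1 hl).1
      rw [List.toFinset_cons, card_filter_powersetCard_insert n ha p, countSub,
        ih (n + 1) hl.of_cons p q fun u hu => h u (hu.cons a),
        ih n hl.of_cons (fun t => p (insert a t)) (fun u => q (a :: u)) fun u hu hn => ?_]
      rw [← List.toFinset_cons]
      exact h (a :: u) (hu.cons_cons a) (by simp [hn])

theorem exists_sublist_toFinset_eq {α : Type*} [DecidableEq α] {l : List α} (hl : l.Nodup)
    {t : Finset α} (ht : t ⊆ l.toFinset) :
    ∃ u : List α, u.Sublist l ∧ u.length = #t ∧ u.toFinset = t := by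
  have h : (l.filter (· ∈ t)).toFinset = t := by
    ext x
    simpa using fun hx => List.mem_toFinset.1 (ht hx)
  refine ⟨l.filter (· ∈ t), List.filter_sublist, ?_, h⟩
  rw [← List.toFinset_card_of_nodup (hl.filter _), h]

/-! ### Counting with bit masks -/

/-- Evaluates `n` to a literal before passing it to `k`. -/
def forceNat {β : Type*} (n : ℕ) (k : ℕ → β) : β :=
  match n with
  | 0 => k 0
  | m + 1 => k (Nat.succ m)

theorem forceNat_eq {β : Type*} (n : ℕ) (k : ℕ → β) : forceNat n k = k n := by
  cases n <;> rfl

/-- Evaluates all the entries of a list before passing it to `k`. -/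
def forceList {β : Type*} : List ℕ → (List ℕ → β) → β
  | [], k => k []
  | a :: l, k => forceNat a fun b => forceList l fun m => k (b :: m)

theorem forceList_eq {β : Type*} (l : List ℕ) (k : List ℕ → β) : forceList l k = k l := by
  induction l generalizing k with
  | nil => rfl
  | cons a l ih => rw [forceList, forceNat_eq, ih]

/-- Evaluates all the entries of a table before passing it to `k`. -/
def forceTable {β : Type*} : List (List ℕ) → (List (List ℕ) → β) → β
  | [], k => k []
  | a :: l, k => forceList a fun b => forceTable l fun m => k (b :: m)

theorem forceTable_eq {β : Type*} (l : List (List ℕ)) (k : List (List ℕ) → β) :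
    forceTable l k = k l := by
  induction l generalizing k with
  | nil => rfl
  | cons a l ih => rw [forceTable, forceList_eq, ih]

/-- The number whose binary digits are the values of `f` along a list. -/
def mask {α : Type*} (f : α → Bool) : List α → ℕ
  | [] => 0
  | w :: ws => Nat.bit (f w) (mask f ws)

/-- The masks of `σ x z` along the part of the list after `z`, for all `z`. -/
def maskRow {α : Type*} (σ : α → α → α → Bool) (x : α) : List α → List ℕ
  | [] => []
  | z :: zs => mask (σ x z) zs :: maskRow σ x zs

/-- The rows `maskRow σ x` along the part of the list after `x`, for all `x`. -/
def maskTable {α : Type*} (σ : α → α → α → Bool) : List α → List (List ℕ)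
  | [] => []
  | x :: xs => maskRow σ x xs :: maskTable σ xs

/-- The number of the lowest `t.length` binary digits of `v` that are equal to `c`. -/
def countBits (c : Bool) : List ℕ → ℕ → ℕ
  | [], _ => 0
  | _ :: t, v => cond (Nat.beq (v % 2) 1 == c)
      (Nat.succ (forceNat (v / 2) (countBits c t))) (forceNat (v / 2) (countBits c t))

/-- The contribution of a pair of points to `evenTable`. -/
def evenPair : List ℕ → List ℕ → ℕ → ℕ
  | a :: r, b :: s, m => Nat.add
      (forceNat (Nat.xor (Nat.xor (m / 2) a) b) (countBits (Nat.beq (m % 2) 1) r))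
      (forceNat (m / 2) (evenPair r s))
  | _, _, _ => 0

/-- The contribution of a point to `evenTable`. -/
def evenRow : List ℕ → List (List ℕ) → ℕ
  | m :: r, s :: t => Nat.add (evenPair r s m) (evenRow r t)
  | _, _ => 0

/-- The number of four-element sublists with an even number of positive triples, computed
from the table of masks. -/
def evenTable : List (List ℕ) → ℕ
  | [] => 0
  | r :: t => Nat.add (evenRow r t) (evenTable t)

/-- Whether the number of positive triples in a list of length four is even. -/
def evenQuad {α : Type*} (σ : α → α → α → Bool) : List α → Bool
  | [x, y, z, w] => (σ x y z == σ x y w) == (σ x z w == σ y z w)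
  | _ => false

theorem mask_xor {α : Type*} (f g : α → Bool) (l : List α) :
    Nat.xor (mask f l) (mask g l) = mask (fun w => Bool.xor (f w) (g w)) l := by
  induction l with
  | nil => exact Nat.xor_self 0
  | cons a l ih =>
    rw [mask, mask, mask, ← ih]
    exact Nat.xor_bit _ _ _ _

theorem mask_cons_div_two {α : Type*} (f : α → Bool) (a : α) (l : List α) :
    mask f (a :: l) / 2 = mask f l := by
  rw [mask, Nat.bit_div_two]

theorem mask_cons_mod_two {α : Type*} (f : α → Bool) (a : α) (l : List α) :
    Nat.beq (mask f (a :: l) % 2) 1 = f a := by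
  rw [mask, Nat.bit_mod_two]
  cases f a <;> rfl

theorem length_maskRow {α : Type*} (σ : α → α → α → Bool) (x : α) (l : List α) :
    (maskRow σ x l).length = l.length := by
  induction l with
  | nil => rfl
  | cons a l ih => simp [maskRow, ih]

theorem countBits_mask {α : Type*} (c : Bool) (f : α → Bool) (t : List ℕ) (l : List α)
    (h : t.length = l.length) :
    countBits c t (mask f l) = countSub 1 l (fun u => u.head?.elim false (fun w => f w == c)) := by
  induction l generalizing t with
  | nil =>
    rw [List.eq_nil_of_length_eq_zero h]
    rfl
  | cons a l ih =>
    cases t with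
    | nil => simp at h
    | cons b t =>
      rw [countBits, forceNat_eq, mask_cons_mod_two, mask_cons_div_two,
        ih t (by simpa using h), countSub, countSub]
      cases hc : f a == c <;> simp [hc, add_comm]

theorem countSub_congr {α : Type*} (n : ℕ) (l : List α) {q q' : List α → Bool}
    (h : ∀ u : List α, u.length = n → q u = q' u) : countSub n l q = countSub n l q' := by
  induction l generalizing n q q' with
  | nil => cases n <;> simp [countSub, h]
  | cons a l ih =>
    cases n with
    | zero => simp [countSub, h]
    | succ n =>
      rw [countSub, countSub, ih (n + 1) h, ih n fun u hu => h (a :: u) (by simp [hu])]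

theorem evenPair_maskRow {α : Type*} (σ : α → α → α → Bool) (x y : α) (l : List α) :
    evenPair (maskRow σ x l) (maskRow σ y l) (mask (σ x y) l) =
      countSub 2 l (fun u => evenQuad σ (x :: y :: u)) := by
  induction l with
  | nil => rfl
  | cons z l ih =>
    rw [maskRow, maskRow, evenPair, forceNat_eq, forceNat_eq, mask_cons_div_two,
      mask_cons_mod_two, ih, mask_xor, mask_xor, countBits_mask _ _ _ _ (length_maskRow σ x l),
      countSub]
    refine congrArg (· + _) (countSub_congr 1 l fun u hu => ?_)
    obtain ⟨w, rfl⟩ := List.length_eq_one_iff.1 hu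
    change (Bool.xor (Bool.xor (σ x y w) (σ x z w)) (σ y z w) == σ x y z) =
      ((σ x y z == σ x y w) == (σ x z w == σ y z w))
    generalize σ x y z = a, σ x y w = b, σ x z w = c, σ y z w = d
    revert a b c d
    decide

theorem evenRow_maskTable {α : Type*} (σ : α → α → α → Bool) (x : α) (l : List α) :
    evenRow (maskRow σ x l) (maskTable σ l) =
      countSub 3 l (fun u => evenQuad σ (x :: u)) := by
  induction l with
  | nil => rfl
  | cons y l ih =>
    rw [maskRow, maskTable, evenRow, evenPair_maskRow, ih, countSub]
    rfl

theorem evenTable_maskTable {α : Type*} (σ : α → α → α → Bool) (l : List α) :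
    evenTable (maskTable σ l) = countSub 4 l (evenQuad σ) := by
  induction l with
  | nil => rfl
  | cons x l ih =>
    rw [maskTable, evenTable, evenRow_maskTable, ih, countSub]
    rfl

/-- Whether `q` holds on all three-element sublists. -/
def allTriples {α : Type*} (q : α → α → α → Bool) : List α → Bool
  | [] => true
  | x :: xs => allPairs (q x) xs && allTriples q xs
where
  /-- Whether `q` holds on all two-element sublists. -/
  allPairs (q : α → α → Bool) : List α → Bool
  | [] => true
  | y :: ys => ys.all (q y) && allPairs q ys

theorem allPairs_sublist {α : Type*} {q : α → α → Bool} {l : List α}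
    (h : allTriples.allPairs q l = true) {y z : α} (hs : [y, z].Sublist l) : q y z = true := by
  induction l with
  | nil => simp at hs
  | cons a l ih =>
    rw [allTriples.allPairs, Bool.and_eq_true, List.all_eq_true] at h
    cases hs with
    | cons _ hs => exact ih h.2 hs
    | cons_cons _ hs => exact h.1 z (by simpa using hs)

theorem allTriples_sublist {α : Type*} {q : α → α → α → Bool} {l : List α}
    (h : allTriples q l = true) {x y z : α} (hs : [x, y, z].Sublist l) : q x y z = true := by
  induction l with
  | nil => simp at hs
  | cons a l ih =>
    rw [allTriples, Bool.and_eq_true] at h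
    cases hs with
    | cons _ hs => exact ih h.2 hs
    | cons_cons _ hs => exact allPairs_sublist h.1 hs

/-! ### Convex position of four points -/

/-- Twice the signed area of the triangle `p q r`. -/
def area (p q r : ℝ × ℝ) : ℝ :=
  (q.1 - p.1) * (r.2 - p.2) - (q.2 - p.2) * (r.1 - p.1)

theorem area_eq_zero_of_collinear {p q r : ℝ × ℝ} (h : Collinear ℝ {p, q, r}) :
    area p q r = 0 := by
  obtain ⟨v, hv⟩ := (collinear_iff_of_mem (p₀ := p) (by simp)).1 h
  obtain ⟨s, rfl⟩ := hv q (by simp)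
  obtain ⟨t, rfl⟩ := hv r (by simp)
  simp [area]
  ring

theorem mem_convexHull_triple {a b c d : ℝ × ℝ} :
    d ∈ convexHull ℝ {a, b, c} ↔ ∃ u v w : ℝ, 0 ≤ u ∧ 0 ≤ v ∧ 0 ≤ w ∧ u + v + w = 1 ∧
      u * a.1 + v * b.1 + w * c.1 = d.1 ∧ u * a.2 + v * b.2 + w * c.2 = d.2 := by
  rw [convexHull_insert (by simp), convexHull_pair, mem_convexJoin]
  constructor
  · rintro ⟨x, rfl, y, ⟨s, t, hs, ht, hst, rfl⟩, s', t', hs', ht', hst', rfl⟩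
    refine ⟨s', t' * s, t' * t, hs', by positivity, by positivity, ?_, ?_, ?_⟩
    · linear_combination t' * hst + hst'
    · simp; ring
    · simp; ring
  · rintro ⟨u, v, w, hu, hv, hw, h, h1, h2⟩
    refine ⟨a, rfl, ?_⟩
    rcases (add_nonneg hv hw).eq_or_lt with h0 | h0
    · obtain rfl : v = 0 := by linarith
      obtain rfl : w = 0 := by linarith
      obtain rfl : u = 1 := by linarith
      refine ⟨b, left_mem_segment ℝ b c, ?_⟩
      have : d = a := Prod.ext (by linarith) (by linarith)
      rw [this]
      exact left_mem_segment ℝ a b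
    · refine ⟨(v / (v + w)) • b + (w / (v + w)) • c,
        ⟨v / (v + w), w / (v + w), by positivity, by positivity, by field_simp, rfl⟩,
        u, v + w, hu, h0.le, by linarith, Prod.ext ?_ ?_⟩
      · simp only [Prod.fst_add, Prod.smul_fst, smul_eq_mul]
        rw [← h1]
        field_simp
        ring
      · simp only [Prod.snd_add, Prod.smul_snd, smul_eq_mul]
        rw [← h2]
        field_simp
        ring

theorem mem_convexHull_of_area {a b c d : ℝ × ℝ} (h : area a b c ≠ 0)
    (hu : 0 ≤ area b c d * area a b c) (hv : area a c d * area a b c ≤ 0)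
    (hw : 0 ≤ area a b d * area a b c) : d ∈ convexHull ℝ {a, b, c} := by
  have h2 : 0 < area a b c * area a b c := mul_self_pos.2 h
  refine mem_convexHull_triple.2 ⟨area b c d * area a b c / (area a b c * area a b c),
    -(area a c d * area a b c) / (area a b c * area a b c),
    area a b d * area a b c / (area a b c * area a b c), div_nonneg hu h2.le,
    div_nonneg (by linarith) h2.le, div_nonneg hw h2.le, ?_, ?_, ?_⟩
  all_goals
    field_simp
    simp only [area]
    ring

theorem area_mul_nonpos_of_mem_convexHull {a b c d : ℝ × ℝ} (h : d ∈ convexHull ℝ {a, b, c}) :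
    area a b c * area a b d * area a c d * area b c d ≤ 0 := by
  obtain ⟨u, v, w, hu, hv, hw, h, h1, h2⟩ := mem_convexHull_triple.1 h
  obtain rfl : u = 1 - v - w := by linarith
  have e1 : area a b d = w * area a b c := by simp only [area, ← h1, ← h2]; ring
  have e2 : area a c d = -(v * area a b c) := by simp only [area, ← h1, ← h2]; ring
  have e3 : area b c d = (1 - v - w) * area a b c := by simp only [area, ← h1, ← h2]; ring
  have := mul_nonneg (mul_nonneg (mul_nonneg hu hv) hw) (sq_nonneg (area a b c ^ 2))
  rw [e1, e2, e3]
  linarith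

theorem convexPos_iff_s16 {a b c d : ℝ × ℝ} (h₁ : area a b c ≠ 0) (h₂ : area a b d ≠ 0)
    (h₃ : area a c d ≠ 0) (h₄ : area b c d ≠ 0) :
    ConvexPos {a, b, c, d} ↔ 0 < area a b c * area a b d * area a c d * area b c d := by
  have hab : a ≠ b := by rintro rfl; exact h₁ (by simp [area])
  have hac : a ≠ c := by rintro rfl; exact h₁ (by simp [area])
  have had : a ≠ d := by rintro rfl; exact h₂ (by simp [area])
  have hbc : b ≠ c := by rintro rfl; exact h₁ (by simp [area]; ring)
  have hbd : b ≠ d := by rintro rfl; exact h₂ (by simp [area]; ring)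
  have hcd : c ≠ d := by rintro rfl; exact h₃ (by simp [area]; ring)
  have ea : ({a, b, c, d} : Set (ℝ × ℝ)) \ {a} = {b, c, d} := by ext x; simp; grind
  have eb : ({a, b, c, d} : Set (ℝ × ℝ)) \ {b} = {a, c, d} := by ext x; simp; grind
  have ec : ({a, b, c, d} : Set (ℝ × ℝ)) \ {c} = {a, b, d} := by ext x; simp; grind
  have ed : ({a, b, c, d} : Set (ℝ × ℝ)) \ {d} = {a, b, c} := by ext x; simp; grind
  have key : ConvexPos {a, b, c, d} ↔ a ∉ convexHull ℝ {b, c, d} ∧ b ∉ convexHull ℝ {a, c, d} ∧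
      c ∉ convexHull ℝ {a, b, d} ∧ d ∉ convexHull ℝ {a, b, c} := by
    simp [ConvexPos, ea, eb, ec, ed]
  have swap (p q r : ℝ × ℝ) : area p r q = -area p q r := by simp only [area]; ring
  have rot (p q r : ℝ × ℝ) : area q r p = area p q r := by simp only [area]; ring
  rw [key]
  constructor
  · rintro ⟨ha, hb, hc, hd⟩
    by_contra hneg
    have ha' := fun u v w => ha (mem_convexHull_of_area h₄ u v w)
    have hb' := fun u v w => hb (mem_convexHull_of_area h₃ u v w)
    have hc' := fun u v w => hc (mem_convexHull_of_area h₂ u v w)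
    have hd' := fun u v w => hd (mem_convexHull_of_area h₁ u v w)
    rw [rot a c d, rot a b d, rot a b c] at ha'
    rw [rot b c d, swap a b d, swap a b c] at hb'
    rw [swap b c d, swap a c d] at hc'
    rcases h₁.lt_or_gt with g₁ | g₁ <;> rcases h₂.lt_or_gt with g₂ | g₂ <;>
      rcases h₃.lt_or_gt with g₃ | g₃ <;> rcases h₄.lt_or_gt with g₄ | g₄ <;>
      simp only [mul_nonneg_iff, mul_nonpos_iff, mul_pos_iff, mul_neg_iff, neg_nonneg,
        neg_nonpos, g₁, g₂, g₃, g₄, g₁.le, g₂.le, g₃.le, g₄.le, g₁.not_ge, g₂.not_ge,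
        g₃.not_ge, g₄.not_ge, g₁.not_gt, g₂.not_gt, g₃.not_gt, g₄.not_gt, and_self, or_self,
        and_true, and_false, or_true, or_false, not_true_eq_false, not_false_eq_true,
        forall_true_left, imp_false] at ha' hb' hc' hd' hneg
  · intro hpos
    refine ⟨fun h => ?_, fun h => ?_, fun h => ?_, fun h => ?_⟩ <;>
      have := area_mul_nonpos_of_mem_convexHull h
    · rw [rot a b c, rot a b d, rot a c d] at this
      linarith
    · rw [swap a b c, swap a b d, rot b c d] at this
      linarith
    · rw [swap a c d, swap b c d] at this
      linarith
    · linarith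

/-! ### The point set -/

/-- The point with coordinates `(a - 100000, b - 100000)` in the basis `1`, `exp (2πi/3)`. -/
noncomputable def latticePoint (p : ℕ × ℕ) : ℝ × ℝ :=
  ((p.1 - 100000) - (p.2 - 100000) / 2, (p.2 - 100000) * (√3 / 2))

/-- Rotation by `2π/3` about the origin, in the coordinates of `latticePoint`. -/
def latticeRot (p : ℕ × ℕ) : ℕ × ℕ :=
  (200000 - p.2, 100000 + p.1 - p.2)

/-- The positive part of the determinant giving the orientation of a triple. -/
def detPos (p q r : ℕ × ℕ) : ℕ :=
  Nat.add (Nat.add (Nat.mul p.1 q.2) (Nat.mul q.1 r.2)) (Nat.mul r.1 p.2)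

/-- The negative part of the determinant giving the orientation of a triple. -/
def detNeg (p q r : ℕ × ℕ) : ℕ :=
  Nat.add (Nat.add (Nat.mul p.2 q.1) (Nat.mul q.2 r.1)) (Nat.mul r.2 p.1)

/-- Whether a triple is oriented counterclockwise. -/
def ccw (p q r : ℕ × ℕ) : Bool :=
  Nat.blt (detNeg p q r) (detPos p q r)

theorem area_latticePoint (p q r : ℕ × ℕ) :
    area (latticePoint p) (latticePoint q) (latticePoint r) =
      √3 / 2 * ((detPos p q r : ℝ) - detNeg p q r) := by
  simp only [area, latticePoint, detPos, detNeg, Nat.add_eq, Nat.mul_eq]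
  push_cast
  ring

theorem area_latticePoint_ne_zero {p q r : ℕ × ℕ} (h : detPos p q r ≠ detNeg p q r) :
    area (latticePoint p) (latticePoint q) (latticePoint r) ≠ 0 := by
  rw [area_latticePoint]
  have : (detPos p q r : ℝ) ≠ detNeg p q r := by exact_mod_cast h
  exact mul_ne_zero (by positivity) (sub_ne_zero.2 this)

theorem area_latticePoint_pos_iff (p q r : ℕ × ℕ) :
    0 < area (latticePoint p) (latticePoint q) (latticePoint r) ↔ ccw p q r = true := by
  rw [area_latticePoint, mul_pos_iff_of_pos_left (by positivity), sub_pos, Nat.cast_lt, ccw,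
    Nat.blt_eq]

theorem latticePoint_injective : Function.Injective latticePoint := by
  rintro ⟨a, b⟩ ⟨c, d⟩ h
  obtain ⟨h1, h2⟩ := Prod.ext_iff.1 h
  have hb : (b : ℝ) = d := by
    have := mul_right_cancel₀ (by positivity) h2
    linarith
  have ha : (a : ℝ) = c := by
    simp only [latticePoint] at h1
    linarith
  exact Prod.ext (by exact_mod_cast ha) (by exact_mod_cast hb)

theorem rot120_latticePoint {p : ℕ × ℕ} (h₁ : p.2 ≤ 200000) (h₂ : p.2 ≤ 100000 + p.1) :
    rot120 0 (latticePoint p) = latticePoint (latticeRot p) := by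
  have hc : Real.cos (2 * Real.pi / 3) = -(1 / 2) := by
    rw [show 2 * Real.pi / 3 = Real.pi - Real.pi / 3 by ring, Real.cos_pi_sub,
      Real.cos_pi_div_three]
  have hs : Real.sin (2 * Real.pi / 3) = √3 / 2 := by
    rw [show 2 * Real.pi / 3 = Real.pi - Real.pi / 3 by ring, Real.sin_pi_sub,
      Real.sin_pi_div_three]
  have h3 : √3 * √3 = 3 := Real.mul_self_sqrt (by norm_num)
  simp only [rot120, latticePoint, latticeRot, hc, hs, Nat.cast_sub h₁, Nat.cast_sub h₂,
    Prod.fst_zero, Prod.snd_zero]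
  push_cast
  refine Prod.ext ?_ ?_
  · linear_combination (-(p.2 - 100000 : ℝ) / 4) * h3
  · ring

/-- The coordinates of the 48 points: three blocks of 16 points, permuted by `latticeRot`. -/
def pts : List (ℕ × ℕ) :=
  [(97568, 94604), (107105, 103110), (116759, 99939), (119290, 100801), (92962, 140375), (151141,
   107533), (134929, 105575), (61134, 54512), (99213, 118580), (92611, 142765), (94982, 92363),
   (141188, 106220), (97359, 122713), (151331, 107560), (88119, 89959), (107186, 103075), (105396,
   102964), (96890, 103995), (100061, 116820), (99199, 118489), (59625, 52587), (92467, 143608),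
   (94425, 129354), (145488, 106622), (81420, 80633), (57235, 49846), (107637, 102619), (93780,
   134968), (77287, 74646), (92440, 143771), (110041, 98160), (96925, 104111), (97036, 102432),
   (96005, 92895), (83180, 83241), (81511, 80710), (147413, 107038), (56392, 48859), (70646,
   65071), (93378, 138866), (119367, 100787), (150154, 107389), (97381, 105018), (65032, 58812),
   (125354, 102641), (56229, 48669), (101840, 111881), (95889, 92814)]

theorem pts_nodup : pts.Nodup := by decide +kernel

theorem map_latticeRot_pts : pts.map latticeRot = pts.rotate 16 := by decide +kernel

theorem pts_le : ∀ p ∈ pts, p.2 ≤ 200000 ∧ p.2 ≤ 100000 + p.1 := by decide +kernel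

theorem allTriples_pts :
    allTriples (fun p q r => !Nat.beq (detPos p q r) (detNeg p q r)) pts = true := by
  decide +kernel

theorem forceTable_pts : forceTable (maskTable ccw pts) evenTable = 71022 := by
  decide +kernel

theorem detPos_ne_detNeg {p q r : ℕ × ℕ} (h : [p, q, r].Sublist pts) :
    detPos p q r ≠ detNeg p q r := by
  intro heq
  have := allTriples_sublist allTriples_pts h
  simp [heq] at this

theorem convexPos_latticePoint_iff {x y z w : ℕ × ℕ} (h : [x, y, z, w].Sublist pts) :
    ConvexPos {latticePoint x, latticePoint y, latticePoint z, latticePoint w} ↔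
      evenQuad ccw [x, y, z, w] = true := by
  have h₁ := area_latticePoint_ne_zero (detPos_ne_detNeg (p := x) (q := y) (r := z)
    (.trans (by simp) h))
  have h₂ := area_latticePoint_ne_zero (detPos_ne_detNeg (p := x) (q := y) (r := w)
    (.trans (by simp) h))
  have h₃ := area_latticePoint_ne_zero (detPos_ne_detNeg (p := x) (q := z) (r := w)
    (.trans (by simp) h))
  have h₄ := area_latticePoint_ne_zero (detPos_ne_detNeg (p := y) (q := z) (r := w)
    (.trans (by simp) h))
  rw [convexPos_iff_s16 h₁ h₂ h₃ h₄, evenQuad]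
  have e₁ := area_latticePoint_pos_iff x y z
  have e₂ := area_latticePoint_pos_iff x y w
  have e₃ := area_latticePoint_pos_iff x z w
  have e₄ := area_latticePoint_pos_iff y z w
  generalize area (latticePoint x) (latticePoint y) (latticePoint z) = a₁ at *
  generalize area (latticePoint x) (latticePoint y) (latticePoint w) = a₂ at *
  generalize area (latticePoint x) (latticePoint z) (latticePoint w) = a₃ at *
  generalize area (latticePoint y) (latticePoint z) (latticePoint w) = a₄ at *
  rcases h₁.lt_or_gt with g₁ | g₁ <;> rcases h₂.lt_or_gt with g₂ | g₂ <;>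
    rcases h₃.lt_or_gt with g₃ | g₃ <;> rcases h₄.lt_or_gt with g₄ | g₄ <;>
    simp_all [mul_pos_iff, mul_neg_iff, not_lt_of_gt]

/-- The 3-symmetric drawing of `K_48`. -/
noncomputable def goodDrawing : Finset (ℝ × ℝ) :=
  pts.toFinset.map ⟨latticePoint, latticePoint_injective⟩

theorem card_goodDrawing : #goodDrawing = 48 := by
  rw [goodDrawing, card_map, List.toFinset_card_of_nodup pts_nodup]
  rfl

theorem genPos_goodDrawing : GenPos goodDrawing := by
  intro p hp q hq r hr hpq hpr hqr hcol
  obtain ⟨t, ht, hmap⟩ := subset_map_iff.1 (show {p, q, r} ⊆ goodDrawing by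
    simp [insert_subset_iff, hp, hq, hr])
  have hcard : #t = 3 := by
    rw [← card_map ⟨latticePoint, latticePoint_injective⟩, ← hmap]
    exact card_eq_three.2 ⟨p, q, r, hpq, hpr, hqr, rfl⟩
  obtain ⟨u, hu, hlen, rfl⟩ := exists_sublist_toFinset_eq pts_nodup ht
  obtain ⟨x, y, z, rfl⟩ := List.length_eq_three.1 (hlen.trans hcard)
  refine area_latticePoint_ne_zero (detPos_ne_detNeg hu) (area_eq_zero_of_collinear ?_)
  have := congrArg (fun s : Finset (ℝ × ℝ) => (s : Set (ℝ × ℝ))) hmap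
  simp at this
  rwa [this] at hcol

theorem threeSym_goodDrawing : ThreeSym goodDrawing := by
  refine ⟨0, ?_, ?_⟩
  · simp only [goodDrawing, mem_map, List.mem_toFinset, Function.Embedding.coeFn_mk]
    rintro ⟨p, hp, h⟩
    have h0 : latticePoint (100000, 100000) = 0 := by simp [latticePoint]
    rw [← h0] at h
    rw [latticePoint_injective h] at hp
    revert hp
    decide +kernel
  · have hco : (goodDrawing : Set (ℝ × ℝ)) = latticePoint '' {p | p ∈ pts} := by
      ext x
      simp [goodDrawing]
    rw [hco, Set.image_image]
    calc (fun p => rot120 0 (latticePoint p)) '' {p | p ∈ pts}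
        = (fun p => latticePoint (latticeRot p)) '' {p | p ∈ pts} :=
          Set.image_congr fun p hp => rot120_latticePoint (pts_le p hp).1 (pts_le p hp).2
      _ = latticePoint '' {p | p ∈ pts.map latticeRot} := by
          ext x
          simp only [Set.mem_image, Set.mem_ofPred_eq, List.mem_map, exists_exists_and_eq_and]
      _ = latticePoint '' {p | p ∈ pts} := by
          rw [map_latticeRot_pts]
          simp

theorem crNum_goodDrawing : crNum goodDrawing = 71022 := by
  classical
  have h : {Q : Finset (ℝ × ℝ) | Q ⊆ goodDrawing ∧ #Q = 4 ∧ ConvexPos (↑Q : Set (ℝ × ℝ))} =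
      ↑((powersetCard 4 goodDrawing).filter
        fun Q : Finset (ℝ × ℝ) => ConvexPos (Q : Set (ℝ × ℝ))) := by
    ext Q
    simp [and_assoc]
  rw [crNum, h, Set.ncard_coe_finset, goodDrawing, powersetCard_map, filter_map, card_map,
    ← forceTable_pts, forceTable_eq, evenTable_maskTable]
  refine card_filter_powersetCard_toFinset_s16 4 pts pts_nodup _ _ fun u hu hlen => ?_
  obtain ⟨x, y, z, w, rfl⟩ : ∃ x y z w, u = [x, y, z, w] := by
    match u, hlen with
    | [x, y, z, w], _ => exact ⟨x, y, z, w, rfl⟩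
  rw [← convexPos_latticePoint_iff hu]
  simp [mapEmbedding_apply]

/-- There is a 3-symmetric set of 48 points in general position with exactly 71022 convex
quadrilaterals; in particular the rectilinear crossing number of `K_48` is at most 71022. -/
theorem exists_good_drawing_K48 :
    ∃ P : Finset (ℝ × ℝ), P.card = 48 ∧ GenPos P ∧ ThreeSym P ∧ crNum P = 71022 ∧
      rcn 48 ≤ 71022 := by
  exact ⟨goodDrawing, card_goodDrawing, genPos_goodDrawing, threeSym_goodDrawing,
    crNum_goodDrawing, Nat.sInf_le ⟨goodDrawing, card_goodDrawing, genPos_goodDrawing,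
      crNum_goodDrawing⟩⟩
end
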